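/- For g ∈ G let r(g) = min_{λ∈ℝ} rank(U_g − λI), let γ_1 ≥ … ≥ γ_{N−1} be the decreasing rearrangement of {r(g) : g ∈ G, g ≠ 1}, and for 2 ≤ n ≤ N−1 set p_n = 2d − γ_{N−n+1}. Let p be an integer with p_n ≤ p ≤ 2d, and set m_i = n for 1 ≤ i ≤ 2d − p and m_i = 1 for 2d − p + 1 ≤ i ≤ p. Then for every choice, for each i ∈ {1,…,p}, of tuples a_i, b_i ∈ G^{m_i} with pairwise distinct entries, the set F = {w = (w_1,…,w_p) ∈ V^p : ∃ x, y ∈ V with x ≁ y and ⟨w_i, U_{a_i(j)}x − U_{b_i(j)}y⟩ = 0 for all i ∈ {1,…,p} and j ∈ {1,…,m_i}} has Lebesgue measure zero and is nowhere dense in V^p. -/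

import Mathlib

open scoped RealInnerProductSpace
open MeasureTheory

/-- `coorbit U w x j` is the `j`-th largest entry (with multiplicity, `1 ≤ j ≤ N = |G|`)
of the `N`-tuple `(⟨U_g w, x⟩)_{g ∈ G}`. -/
noncomputable def coorbit {d : ℕ} {G : Type} [Group G] [Fintype G]
    (U : G →* (EuclideanSpace ℝ (Fin d) ≃ₗᵢ[ℝ] EuclideanSpace ℝ (Fin d)))
    (w x : EuclideanSpace ℝ (Fin d)) (j : ℕ) : ℝ :=
  ((Finset.univ.val.map fun g : G => ⟪(U g) w, x⟫).sort (· ≤ ·)).getD (Fintype.card G - j) 0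

/-- `dhat U x y = min_{g ∈ G} ‖x − U_g y‖`, the orbit distance. -/
noncomputable def dhat {d : ℕ} {G : Type} [Group G] [Fintype G]
    (U : G →* (EuclideanSpace ℝ (Fin d) ≃ₗᵢ[ℝ] EuclideanSpace ℝ (Fin d)))
    (x y : EuclideanSpace ℝ (Fin d)) : ℝ :=
  Finset.univ.inf' Finset.univ_nonempty fun g : G => ‖x - (U g) y‖
/-- `rankMin U g = min_{λ ∈ ℝ} rank (U_g − λ I)` (the minimum of the set of possible
ranks, which is attained since ranks are natural numbers). -/
noncomputable def rankMin {d : ℕ} {G : Type} [Group G] [Fintype G]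
    (U : G →* (EuclideanSpace ℝ (Fin d) ≃ₗᵢ[ℝ] EuclideanSpace ℝ (Fin d))) (g : G) : ℕ :=
  sInf {k : ℕ | ∃ c : ℝ, Module.finrank ℝ (LinearMap.range
    (((U g).toLinearEquiv : EuclideanSpace ℝ (Fin d) →ₗ[ℝ] EuclideanSpace ℝ (Fin d))
      - c • LinearMap.id)) = k}

/-- The increasingly sorted list of the multiset `{rankMin U g : g ∈ G, g ≠ 1}`.  The
`k`-th largest element `γ_k` (`1 ≤ k ≤ N−1`) of this multiset is
`(gammaSorted U).getD (N - 1 - k) 0`; in particular `γ_{N−n+1} = (gammaSorted U).getD (n-2) 0`. -/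
noncomputable def gammaSorted {d : ℕ} {G : Type} [Group G] [Fintype G] [DecidableEq G]
    (U : G →* (EuclideanSpace ℝ (Fin d) ≃ₗᵢ[ℝ] EuclideanSpace ℝ (Fin d))) : List ℕ :=
  ((Finset.univ.filter fun g : G => g ≠ 1).val.map (rankMin U)).sort (· ≤ ·)
section RelativeAlgebraicClosure

variable {k L : Type*} [Field k] [Field L] [Algebra k L]

/-- The relative algebraic closure in `L` of the field generated by `T` over `k`. -/
noncomputable def algCl (k : Type*) {L : Type*} [Field k] [Field L] [Algebra k L] (T : Set L) :
    IntermediateField k L :=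
  (algebraicClosure (IntermediateField.adjoin k T) L).restrictScalars k

theorem mem_algCl_iff_isAlgebraic {T : Set L} {a : L} :
    a ∈ algCl k T ↔ IsAlgebraic (IntermediateField.adjoin k T) a := by
  rw [algCl, IntermediateField.mem_restrictScalars, mem_algebraicClosure_iff]

theorem mem_algCl_iff {T : Set L} {a : L} :
    a ∈ algCl k T ↔ a ∈ (AlgebraicIndependent.matroid k L).closure T := by
  rw [mem_algCl_iff_isAlgebraic, AlgebraicIndependent.matroid_closure_eq,
    IntermediateField.isAlgebraic_adjoin_iff]
  rfl

theorem coe_algCl (T : Set L) :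
    (algCl k T : Set L) = (AlgebraicIndependent.matroid k L).closure T := by
  ext a
  exact mem_algCl_iff

theorem subset_algCl (T : Set L) : T ⊆ algCl k T := by
  rw [coe_algCl]
  exact Matroid.subset_closure _ _

theorem algCl_mono {S T : Set L} (h : S ⊆ T) : algCl k S ≤ algCl k T := by
  intro a
  simp only [mem_algCl_iff]
  exact fun ha => Matroid.closure_subset_closure _ h ha

theorem algCl_le_of_subset {S T : Set L} (h : S ⊆ algCl k T) : algCl k S ≤ algCl k T := by
  intro a
  rw [coe_algCl] at h
  simp only [mem_algCl_iff]
  exact fun ha => Matroid.closure_subset_closure_of_subset_closure h ha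

theorem mem_algCl_of_isAlgebraic {T : Set L} {a : L} (h : IsAlgebraic (algCl k T) a) :
    a ∈ algCl k T := by
  rw [mem_algCl_iff_isAlgebraic]
  change IsAlgebraic (algebraicClosure (IntermediateField.adjoin k T) L) a at h
  exact h.restrictScalars _

theorem mem_algCl_exchange {T : Set L} {a b : L} (ha : a ∉ algCl k T)
    (hab : a ∈ algCl k (insert b T)) : b ∈ algCl k (insert a T) := by
  rw [mem_algCl_iff] at *
  exact Matroid.mem_closure_insert ha hab

theorem mem_algCl_empty {a : L} : a ∈ algCl k (∅ : Set L) ↔ IsAlgebraic k a := by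
  rw [mem_algCl_iff_isAlgebraic]
  have : Algebra.IsAlgebraic k (IntermediateField.adjoin k (∅ : Set L)) :=
    IntermediateField.isAlgebraic_adjoin (by simp)
  exact ⟨fun h => h.restrictScalars k, fun h => h.extendScalars
    (FaithfulSMul.algebraMap_injective _ _)⟩

/-- A vector spans at most `#ι - r` dimensions if it satisfies `r` independent linear relations. -/
theorem finrank_span_add_le {K : Type*} [Field K] [Algebra K L] {ι κ : Type*} [Fintype ι]
    [Fintype κ] {v : κ → ι → K} (hv : LinearIndependent K v) {z : ι → L}
    (hz : ∀ j, ∑ i, v j i • z i = 0) :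
    Module.finrank K (Submodule.span K (Set.range z)) + Fintype.card κ ≤ Fintype.card ι := by
  have h1 := (Fintype.linearCombination K z).finrank_range_add_finrank_ker
  rw [Fintype.range_linearCombination, Module.finrank_fintype_fun_eq_card] at h1
  have h2 : Submodule.span K (Set.range v) ≤ (Fintype.linearCombination K z).ker := by
    rw [Submodule.span_le]
    rintro _ ⟨j, rfl⟩
    simpa [Fintype.linearCombination_apply] using hz j
  have h3 := Submodule.finrank_mono h2
  rw [finrank_span_eq_card hv] at h3
  omega

theorem exists_finset_span_eq {K : Type*} [Field K] [Algebra K L] {ι : Type*} [Finite ι]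
    (z : ι → L) : ∃ B : Finset L, B.card = Module.finrank K (Submodule.span K (Set.range z)) ∧
      (B : Set L) ⊆ Set.range z ∧
        Submodule.span K (B : Set L) = Submodule.span K (Set.range z) := by
  obtain ⟨b, hb, hs, hl⟩ := exists_linearIndependent K (Set.range z)
  have hf : b.Finite := (Set.finite_range z).subset hb
  have := hf.fintype
  refine ⟨b.toFinset, ?_, by simpa using hb, by simpa using hs⟩
  rw [← hs, finrank_span_set_eq_card hl]

theorem mem_algCl_of_mem_span {K : Type*} [Field K] [Algebra K L] {S T : Set L}
    (hK : ∀ a : K, algebraMap K L a ∈ algCl k T) (hS : S ⊆ algCl k T) {a : L}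
    (ha : a ∈ Submodule.span K S) : a ∈ algCl k T := by
  induction ha using Submodule.span_induction with
  | mem x h => exact hS h
  | zero => exact zero_mem _
  | add x y _ _ hx hy => exact add_mem hx hy
  | smul c x _ hx =>
    rw [Algebra.smul_def]
    exact mul_mem (hK c) hx

/-- Up to scaling, the vector `z` has entries in `algCl k T`. -/
def ProjMem (k : Type*) {L : Type*} [Field k] [Field L] [Algebra k L] {ι : Type*}
    (T : Set L) (z : ι → L) : Prop :=
  ∃ s : L, s ≠ 0 ∧ ∀ i, s * z i ∈ algCl k T

theorem ProjMem.mono {ι : Type*} {S T : Set L} (h : S ⊆ T) {z : ι → L} (hz : ProjMem k S z) :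
    ProjMem k T z := by
  obtain ⟨s, hs, hsz⟩ := hz
  exact ⟨s, hs, fun i => algCl_mono h (hsz i)⟩

/-- A nonzero vector spanning `r + 1` dimensions over `K ⊆ algCl k T` is, up to scaling,
defined over `algCl k` of `T` and `r` further elements. -/
theorem exists_projective_generators [DecidableEq L] {K : Type*} [Field K] [Algebra K L]
    {ι : Type*} [Finite ι] {z : ι → L} (hz : z ≠ 0) (T : Finset L)
    (hK : ∀ a : K, algebraMap K L a ∈ algCl k (T : Set L)) :
    ∃ T' : Finset L, T ⊆ T' ∧
      T'.card + 1 ≤ T.card + Module.finrank K (Submodule.span K (Set.range z)) ∧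
      ∃ s : L, s ≠ 0 ∧ ∀ a ∈ Submodule.span K (Set.range z), s * a ∈ algCl k (T' : Set L) := by
  obtain ⟨B, hc, hB, hs⟩ := exists_finset_span_eq (K := K) z
  have hne : ∃ b ∈ B, b ≠ 0 := by
    by_contra! h
    apply hz
    funext i
    have : z i ∈ Submodule.span K (B : Set L) := hs ▸ Submodule.subset_span ⟨i, rfl⟩
    have h0 : Submodule.span K (B : Set L) = ⊥ := by
      rw [Submodule.span_eq_bot]
      exact fun b hb => h b hb
    simpa [h0] using this
  obtain ⟨b, hbB, hb0⟩ := hne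
  refine ⟨T ∪ (B.erase b).image (b⁻¹ * ·), Finset.subset_union_left, ?_, b⁻¹, inv_ne_zero hb0, ?_⟩
  · have h1 := Finset.card_union_le T ((B.erase b).image (b⁻¹ * ·))
    have h2 : ((B.erase b).image (b⁻¹ * ·)).card ≤ (B.erase b).card := Finset.card_image_le
    have h3 := Finset.card_erase_add_one hbB
    omega
  · intro a ha
    rw [← hs] at ha
    induction ha using Submodule.span_induction with
    | mem x h =>
      by_cases hx : x = b
      · rw [hx, inv_mul_cancel₀ hb0]
        exact one_mem _
      · refine subset_algCl _ ?_
        rw [Finset.mem_coe, Finset.mem_union]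
        exact Or.inr (Finset.mem_image_of_mem _ (Finset.mem_erase.2 ⟨hx, h⟩))
    | zero => rw [mul_zero]; exact zero_mem _
    | add x y _ _ hx hy => rw [mul_add]; exact add_mem hx hy
    | smul c x _ hx =>
      rw [Algebra.smul_def, mul_left_comm]
      exact mul_mem (algCl_mono (by simp) (hK c)) hx

/-- Fibre dimension count: if `w` is generic and each `w i` spans at most `d - s i` dimensions over
the relative algebraic closure of `T`, then `T` has at least `∑ i, s i` elements. -/
theorem sum_codim_le_card [DecidableEq L] {ι κ : Type*} [Fintype ι] [Fintype κ] {w : ι → κ → L}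
    (hw : AlgebraicIndependent k fun ij : ι × κ => w ij.1 ij.2) (T : Finset L) (s : ι → ℕ)
    (h : ∀ i, Module.finrank (algCl k (T : Set L))
      (Submodule.span (algCl k (T : Set L)) (Set.range (w i))) + s i ≤ Fintype.card κ) :
    ∑ i, s i ≤ T.card := by
  choose B hc hB hs using fun i => exists_finset_span_eq (K := algCl k (T : Set L)) (w i)
  set T' : Finset L := T ∪ Finset.univ.biUnion B with hT'
  have hmem : Set.range (fun ij : ι × κ => w ij.1 ij.2) ⊆ algCl k (T' : Set L) := by
    rintro _ ⟨⟨i, j⟩, rfl⟩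
    refine mem_algCl_of_mem_span (K := algCl k (T : Set L)) (S := (B i : Set L)) ?_ ?_ ?_
    · exact fun a => algCl_mono (by simp [hT']) a.2
    · refine subset_trans ?_ (subset_algCl _)
      intro b hb
      simp only [hT', Finset.coe_union, Finset.coe_biUnion]
      exact Or.inr (Set.mem_biUnion (Finset.mem_univ i) hb)
    · rw [hs]
      exact Submodule.subset_span ⟨j, rfl⟩
  have hind : (AlgebraicIndependent.matroid k L).Indep
      (Set.range (fun ij : ι × κ => w ij.1 ij.2)) :=
    AlgebraicIndependent.matroid_indep_iff.2 hw.coe_range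
  rw [coe_algCl] at hmem
  have h1 := hind.encard_le_eRk_of_subset hmem
  rw [Matroid.eRk_closure_eq] at h1
  have h2 := h1.trans (Matroid.eRk_le_encard _ _)
  rw [Set.encard_coe_eq_coe_finsetCard, Set.encard_eq_coe_toFinset_card] at h2
  have h3 : (Set.range (fun ij : ι × κ => w ij.1 ij.2)).toFinset.card =
      Fintype.card ι * Fintype.card κ := by
    rw [Set.toFinset_card, Set.card_range_of_injective hw.injective, Fintype.card_prod]
  rw [h3] at h2
  have h4 : Fintype.card ι * Fintype.card κ ≤ T'.card := by exact_mod_cast h2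
  have h5 : T'.card ≤ T.card + ∑ i, (B i).card :=
    (Finset.card_union_le _ _).trans (Nat.add_le_add_left Finset.card_biUnion_le _)
  have h6 : ∑ i, (B i).card + ∑ i, s i ≤ Fintype.card ι * Fintype.card κ := by
    rw [← Finset.sum_add_distrib]
    calc _ ≤ ∑ _i : ι, Fintype.card κ := Finset.sum_le_sum fun i _ => by rw [hc]; exact h i
      _ = _ := by simp
  omega

/-- A family of `#I` hyperplanes, each containing a generic vector, has at least `#I` parameters. -/
theorem card_le_of_projMem [DecidableEq L] {ι κ : Type*} [Fintype ι] [Fintype κ] [DecidableEq ι]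
    {w u : ι → κ → L} (hw : AlgebraicIndependent k fun ij : ι × κ => w ij.1 ij.2)
    (hu : ∀ i, u i ≠ 0) (hwu : ∀ i, ∑ j, w i j * u i j = 0) (T : Finset L) (I : Finset ι)
    (h : ∀ i ∈ I, ProjMem k (T : Set L) (u i)) : I.card ≤ T.card := by
  have := sum_codim_le_card hw T (fun i => if i ∈ I then 1 else 0) ?_
  · simpa using this
  intro i
  by_cases hi : i ∈ I
  · obtain ⟨s, hs, hsu⟩ := h i hi
    have := finrank_span_add_le (K := algCl k (T : Set L)) (κ := Unit) (z := w i)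
      (v := fun _ j => ⟨s * u i j, hsu j⟩) ?_ ?_
    · simpa [hi] using this
    · rw [linearIndependent_unique_iff]
      intro h0
      apply hu i
      funext j
      have := congrArg (Subtype.val) (congrFun h0 j)
      simpa [hs] using this
    · intro _
      simp only [Algebra.smul_def, IntermediateField.algebraMap_apply]
      have := congrArg (s * ·) (hwu i)
      simp only [Finset.mul_sum, mul_zero] at this
      rw [← this]
      exact Finset.sum_congr rfl fun j _ => by ring
  · simp only [hi, if_false, add_zero]
    exact finrank_range_le_card (R := algCl k (T : Set L)) (w i)

theorem card_add_one_le_of_mem_span [DecidableEq L] {ι κ μ : Type*} [Fintype ι] [Fintype κ]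
    [DecidableEq ι] [Finite μ] {w u : ι → κ → L}
    (hw : AlgebraicIndependent k fun ij : ι × κ => w ij.1 ij.2)
    (hu : ∀ i, u i ≠ 0) (hwu : ∀ i, ∑ j, w i j * u i j = 0) (T : Finset L) (I : Finset ι)
    {K : Type*} [Field K] [Algebra K L] (hK : ∀ a : K, algebraMap K L a ∈ algCl k (T : Set L))
    {z : μ → L} (hz : z ≠ 0)
    (h : ∀ i ∈ I, ProjMem k (T : Set L) (u i) ∨
      ∃ s : L, s ≠ 0 ∧ ∀ j, s * u i j ∈ Submodule.span K (Set.range z)) :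
    I.card + 1 ≤ T.card + Module.finrank K (Submodule.span K (Set.range z)) := by
  obtain ⟨T', hT, hc, s, hs, hmem⟩ := exists_projective_generators (k := k) hz T hK
  have := card_le_of_projMem hw hu hwu T' I fun i hi => (h i hi).elim
    (fun h => h.mono (by simpa using hT)) fun ⟨r, hr, h⟩ =>
      ⟨s * r, mul_ne_zero hs hr, fun j => by rw [mul_assoc]; exact hmem _ (h j)⟩
  omega

end RelativeAlgebraicClosure
section Act

variable {R S V l m n : Type*} [Fintype m] [Fintype n]

/-- The action of a matrix on tuples of elements of a module. -/
def Matrix.act [Semiring R] [AddCommMonoid V] [Module R V] (N : Matrix l n R) (z : n → V) : l → V :=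
  fun i => ∑ j, N i j • z j

namespace Matrix

theorem act_mul [Semiring R] [AddCommMonoid V] [Module R V] (M : Matrix l m R) (N : Matrix m n R)
    (z : n → V) : (M * N).act z = M.act (N.act z) := by
  funext i
  simp only [act, mul_apply, Finset.sum_smul, Finset.smul_sum, mul_smul]
  exact Finset.sum_comm

theorem one_act [DecidableEq n] [Semiring R] [AddCommMonoid V] [Module R V] (z : n → V) :
    (1 : Matrix n n R).act z = z := by
  funext i
  simp [act, one_apply, ite_smul]

theorem add_act [Semiring R] [AddCommMonoid V] [Module R V] (M N : Matrix l n R)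
    (z : n → V) : (M + N).act z = M.act z + N.act z := by
  funext i
  simp [act, add_smul, Finset.sum_add_distrib]

theorem sub_act [Ring R] [AddCommGroup V] [Module R V] (M N : Matrix l n R)
    (z : n → V) : (M - N).act z = M.act z - N.act z := by
  funext i
  simp [act, sub_smul]

theorem neg_act [Ring R] [AddCommGroup V] [Module R V] (M : Matrix l n R)
    (z : n → V) : (-M).act z = -M.act z := by
  funext i
  simp [act]

theorem act_sub [Ring R] [AddCommGroup V] [Module R V] (M : Matrix l n R)
    (y z : n → V) : M.act (y - z) = M.act y - M.act z := by
  funext i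
  simp [act, smul_sub]

theorem act_add [Ring R] [AddCommGroup V] [Module R V] (M : Matrix l n R)
    (y z : n → V) : M.act (y + z) = M.act y + M.act z := by
  funext i
  simp [act, smul_add, Finset.sum_add_distrib]

theorem act_zero [Semiring R] [AddCommMonoid V] [Module R V] (M : Matrix l n R) :
    M.act (0 : n → V) = 0 := by
  funext i
  simp [act]

theorem smul_act [Semiring R] [AddCommMonoid V] [Module R V] (c : R) (M : Matrix l n R)
    (z : n → V) : (c • M).act z = c • M.act z := by
  funext i
  simp [act, Finset.smul_sum, mul_smul]

theorem act_smul [CommSemiring R] [Semiring S] [Algebra R S] (M : Matrix l n R)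
    (c : S) (z : n → S) : M.act (c • z) = c • M.act z := by
  funext i
  simp [act, Finset.mul_sum]

theorem map_algebraMap_act [CommSemiring R] [Semiring S] [Algebra R S] [AddCommMonoid V]
    [Module R V] [Module S V] [IsScalarTower R S V] (M : Matrix l n R) (z : n → V) :
    (M.map (algebraMap R S)).act z = M.act z := by
  funext i
  simp [act]

theorem act_mem_span [Semiring R] [AddCommMonoid V] [Module R V] (M : Matrix l n R)
    (z : n → V) (i : l) : M.act z i ∈ Submodule.span R (Set.range z) :=
  Submodule.sum_mem _ fun j _ => Submodule.smul_mem _ _ (Submodule.subset_span ⟨j, rfl⟩)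

theorem eq_zero_of_act_eq_zero [Ring R] [AddCommGroup V] [Module R V] {z : n → V}
    (hz : LinearIndependent R z) {M : Matrix l n R} (h : M.act z = 0) : M = 0 := by
  ext i j
  exact Fintype.linearIndependent_iff.1 hz (M i) (congrFun h i) j

theorem eq_of_act_eq_act [Ring R] [AddCommGroup V] [Module R V] {z : n → V}
    (hz : LinearIndependent R z) {M N : Matrix l n R} (h : M.act z = N.act z) : M = N := by
  rw [← sub_eq_zero]
  exact eq_zero_of_act_eq_zero hz (by rw [sub_act, h, sub_self])

end Matrix

end Act

section Pencil

open Matrix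

variable {k K L κ : Type*} [Field k] [Field K] [Field L] [Algebra k K] [Algebra k L] [Algebra K L]
  [IsScalarTower k K L] [Fintype κ]

theorem det_pencil_ne_zero [DecidableEq κ] {C E : Matrix κ κ k} (hC : C.det ≠ 0) {c : K}
    (hc : Transcendental k c) :
    (C.map (algebraMap k K) - c • E.map (algebraMap k K)).det ≠ 0 := by
  intro h
  let P : Polynomial k :=
    (C.map Polynomial.C - (Polynomial.X : Polynomial k) • E.map Polynomial.C).det
  have h0 : P.eval 0 = C.det := by
    change Polynomial.evalRingHom 0 P = _
    rw [RingHom.map_det]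
    congr 1
    ext i j
    simp
  have hP : P ≠ 0 := by
    rintro hP
    rw [hP, Polynomial.eval_zero] at h0
    exact hC h0.symm
  apply hc
  refine ⟨P, hP, ?_⟩
  change (Polynomial.aeval c : Polynomial k →ₐ[k] K).toRingHom P = 0
  rw [RingHom.map_det, ← h]
  congr 1
  ext i j
  simpa using mul_comm _ _

theorem pencil_matrix_eq {C D E F : Matrix κ κ k} {c : K} {x y : κ → L} {M : Matrix κ κ K}
    (hy : LinearIndependent K y) (hx : x = M.act y)
    (h : C.act x - D.act y = algebraMap K L c • (E.act x - F.act y)) :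
    (C.map (algebraMap k K) - c • E.map (algebraMap k K)) * M =
      D.map (algebraMap k K) - c • F.map (algebraMap k K) := by
  apply eq_of_act_eq_act hy
  rw [act_mul, ← hx, sub_act, sub_act, smul_act, smul_act, map_algebraMap_act, map_algebraMap_act,
    map_algebraMap_act, map_algebraMap_act, sub_eq_sub_iff_add_eq_add]
  rw [sub_eq_iff_eq_add, smul_sub, algebraMap_smul, algebraMap_smul] at h
  rw [h]
  abel

theorem exists_pencil_parametrization [DecidableEq κ] {C D E F : Matrix κ κ k} (hC : C.det ≠ 0)
    {c : K}
    (hc : Transcendental k c) {x y : κ → L}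
    (h : C.act x - D.act y = algebraMap K L c • (E.act x - F.act y)) :
    ∃ M : Matrix κ κ K, x = M.act y ∧
      (C.map (algebraMap k K) - c • E.map (algebraMap k K)) * M =
        D.map (algebraMap k K) - c • F.map (algebraMap k K) := by
  set Q := C.map (algebraMap k K) - c • E.map (algebraMap k K) with hQ
  have hdet : IsUnit Q.det := (det_pencil_ne_zero hC hc).isUnit
  refine ⟨Q⁻¹ * (D.map (algebraMap k K) - c • F.map (algebraMap k K)), ?_, ?_⟩
  · have h2 : Q.act x = (D.map (algebraMap k K) - c • F.map (algebraMap k K)).act y := by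
      rw [sub_act, sub_act, smul_act, smul_act, map_algebraMap_act, map_algebraMap_act,
        map_algebraMap_act, map_algebraMap_act, sub_eq_sub_iff_add_eq_add]
      rw [sub_eq_iff_eq_add, smul_sub, algebraMap_smul, algebraMap_smul] at h
      rw [h]
      abel
    rw [act_mul, ← h2, ← act_mul, nonsing_inv_mul _ hdet, one_act]
  · rw [← mul_assoc, mul_nonsing_inv _ hdet, one_mul]

/-- If a pencil of matrices over a relatively algebraically closed field degenerates to rank one
at an element outside the field, then the image of its constant term is a line over the field. -/
theorem exists_column_of_singular_pencil {K K' : Type*} [Field K] [Field K'] [Algebra K L]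
    [Algebra K' L] (hK : ∀ a : L, IsAlgebraic K a → a ∈ (algebraMap K L).range)
    (hKK : (algebraMap K L).range ≤ (algebraMap K' L).range) {c : L}
    (hc : c ∉ (algebraMap K L).range) (hc' : c ∈ (algebraMap K' L).range) {y : κ → L}
    (hy : Fintype.card κ ≤ Module.finrank K' (Submodule.span K' (Set.range y)) + 1)
    {N N' : Matrix κ κ K} (h : N.act y = c • N'.act y) (h0 : N.act y ≠ 0) :
    ∃ b : κ, ∃ s : L, s ≠ 0 ∧ ∀ a, s * N.act y a = algebraMap K L (N a b) := by
  have hminor : ∀ a a' b b', N a b * N a' b' = N a b' * N a' b := by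
    intro a a' b b'
    set f := algebraMap K L with hf
    have key : (f (N a b) - c * f (N' a b)) * (f (N a' b') - c * f (N' a' b')) =
        (f (N a b') - c * f (N' a b')) * (f (N a' b) - c * f (N' a' b)) := by
      by_contra hne
      have hex : ∀ a b, ∃ r : K', algebraMap K' L r = f (N a b) - c * f (N' a b) := fun a b =>
        sub_mem (hKK ⟨_, rfl⟩) (mul_mem hc' (hKK ⟨_, rfl⟩))
      choose r hr using hex
      rw [← hr, ← hr, ← hr, ← hr, ← map_mul, ← map_mul] at hne
      have hne' : r a b * r a' b' ≠ r a b' * r a' b := fun h => hne (by rw [h])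
      have hrow : ∀ a, ∑ j, r a j • y j = 0 := by
        intro a
        have := congrFun h a
        simp only [act, Pi.smul_apply, smul_eq_mul, Algebra.smul_def, Finset.mul_sum] at this
        simp only [Algebra.smul_def, hr, sub_mul, Finset.sum_sub_distrib]
        rw [sub_eq_zero, this]
        exact Finset.sum_congr rfl fun j _ => by ring
      have hli : LinearIndependent K' ![r a, r a'] := by
        rw [LinearIndependent.pair_iff]
        intro s t hst
        have h1 := congrFun hst b
        have h2 := congrFun hst b'
        simp only [Pi.add_apply, Pi.smul_apply, smul_eq_mul, Pi.zero_apply] at h1 h2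
        have hd : r a b * r a' b' - r a b' * r a' b ≠ 0 := sub_ne_zero.2 hne'
        constructor
        · refine (mul_eq_zero.1 (?_ : s * (r a b * r a' b' - r a b' * r a' b) = 0)).resolve_right hd
          linear_combination r a' b' * h1 - r a' b * h2
        · refine (mul_eq_zero.1 (?_ : t * (r a b * r a' b' - r a b' * r a' b) = 0)).resolve_right hd
          linear_combination -r a b' * h1 + r a b * h2
      have := finrank_span_add_le hli (z := y) (by
        intro j
        fin_cases j
        · exact hrow a
        · exact hrow a')
      simp only [Fintype.card_fin] at this
      omega
    by_contra hne
    apply hc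
    apply hK
    let α := N a b * N a' b' - N a b' * N a' b
    let β := N a b' * N' a' b + N' a b' * N a' b - N a b * N' a' b' - N' a b * N a' b'
    let δ := N' a b * N' a' b' - N' a b' * N' a' b
    refine ⟨Polynomial.C α + Polynomial.C β * Polynomial.X + Polynomial.C δ * Polynomial.X ^ 2,
      ?_, ?_⟩
    · intro hP
      have := congrArg (Polynomial.eval 0) hP
      simp only [Polynomial.eval_add, Polynomial.eval_C, Polynomial.eval_mul, Polynomial.eval_X,
        Polynomial.eval_pow, Polynomial.eval_zero] at this
      apply hne
      rw [← sub_eq_zero]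
      simpa using this
    · simp only [map_add, map_mul, Polynomial.aeval_C, Polynomial.aeval_X, map_pow, α, β, δ,
        map_sub, ← hf]
      linear_combination key
  have hN : ∃ a b, N a b ≠ 0 := by
    by_contra! hz
    apply h0
    funext i
    simp [act, hz]
  obtain ⟨a0, b0, hab⟩ := hN
  have hNy : ∀ a, algebraMap K L (N a0 b0) * N.act y a =
      algebraMap K L (N a b0) * N.act y a0 := by
    intro a
    simp only [act, Algebra.smul_def, Finset.mul_sum]
    refine Finset.sum_congr rfl fun j _ => ?_
    rw [← mul_assoc, ← mul_assoc, ← map_mul, ← map_mul, hminor a0 a b0 j, mul_comm (N a0 j)]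
  have hab' : algebraMap K L (N a0 b0) ≠ 0 := by simpa using hab
  have hy0 : N.act y a0 ≠ 0 := by
    intro hz
    apply h0
    funext a
    have := hNy a
    rw [hz, mul_zero] at this
    exact (mul_eq_zero.1 this).resolve_left hab'
  refine ⟨b0, algebraMap K L (N a0 b0) * (N.act y a0)⁻¹, mul_ne_zero hab' (inv_ne_zero hy0), ?_⟩
  intro a
  have := hNy a
  field_simp
  linear_combination this

theorem mul_eq_mul_of_transcendental_ratio {c c' : L} (hc : Transcendental k c)
    (hc' : Transcendental k c') {a b a' b' e f e' f' : k}
    (h : algebraMap k L a + c * algebraMap k L b =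
      c' * (algebraMap k L e + c * algebraMap k L f))
    (h' : algebraMap k L a' + c * algebraMap k L b' =
      c' * (algebraMap k L e' + c * algebraMap k L f')) : a * b' = a' * b := by
  have hquad : ∀ p q r : k, algebraMap k L p + algebraMap k L q * c + algebraMap k L r * c ^ 2 = 0 →
      p = 0 ∧ q = 0 ∧ r = 0 := by
    intro p q r hpqr
    have hP : (Polynomial.C p + Polynomial.C q * Polynomial.X +
        Polynomial.C r * Polynomial.X ^ 2 : Polynomial k) = 0 := by
      by_contra hne
      exact hc ⟨_, hne, by simpa using hpqr⟩
    refine ⟨?_, ?_, ?_⟩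
    · simpa using congrArg (Polynomial.coeff · 0) hP
    · simpa [Polynomial.coeff_X, Polynomial.coeff_C] using congrArg (Polynomial.coeff · 1) hP
    · simpa [Polynomial.coeff_X, Polynomial.coeff_C] using congrArg (Polynomial.coeff · 2) hP
  by_contra hne
  have hc0 : c' ≠ 0 := fun h0 => hc' (h0 ▸ isAlgebraic_zero)
  have hcross : (algebraMap k L a + c * algebraMap k L b) *
      (algebraMap k L e' + c * algebraMap k L f') =
      (algebraMap k L a' + c * algebraMap k L b') *
      (algebraMap k L e + c * algebraMap k L f) := by
    rw [h, h']; ring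
  obtain ⟨h1, h2, h3⟩ := hquad (a * e' - a' * e) (a * f' + b * e' - a' * f - b' * e)
    (b * f' - b' * f) (by simp only [map_sub, map_mul, map_add]; linear_combination hcross)
  have hd : a * b' - a' * b ≠ 0 := sub_ne_zero.2 hne
  -- the numerators are coprime, hence proportional to the denominators
  have key : ∃ t : k, e = t * a ∧ f = t * b := by
    refine ⟨(e * b' - e' * b) / (a * b' - a' * b), ?_, ?_⟩
    · rw [div_mul_eq_mul_div, eq_div_iff hd]
      linear_combination b * h1
    · rw [div_mul_eq_mul_div, eq_div_iff hd]
      linear_combination b * h2 - a * h3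
  obtain ⟨t, rfl, rfl⟩ := key
  have hab : algebraMap k L a + c * algebraMap k L b ≠ 0 := by
    intro h0
    obtain ⟨ha, hb, -⟩ := hquad a b 0 (by simp only [map_zero]; linear_combination h0)
    apply hne
    rw [ha, hb, zero_mul, mul_zero]
  have ht : algebraMap k L t * c' = 1 := by
    apply mul_right_cancel₀ hab
    simp only [map_mul] at h
    linear_combination -h
  apply hc'
  have : c' = algebraMap k L t⁻¹ := by
    rw [map_inv₀]
    exact eq_inv_of_mul_eq_one_right ht
  rw [this]
  exact isAlgebraic_algebraMap _

theorem act_sub_act_eq {C D : Matrix κ κ k} {M : Matrix κ κ K} {x y : κ → L} (hx : x = M.act y) :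
    C.act x - D.act y = (C.map (algebraMap k K) * M - D.map (algebraMap k K)).act y := by
  rw [sub_act, act_mul, ← hx, map_algebraMap_act, map_algebraMap_act]

theorem eq_zero_of_algebraMap_eq_mul {a b : k} {t : L} (ht : Transcendental k t)
    (h : algebraMap k L a = t * algebraMap k L b) : a = 0 := by
  by_cases hb : b = 0
  · simpa [hb] using h
  · have hb' : algebraMap k L b ≠ 0 := by simpa using hb
    exact absurd (by rw [(eq_div_iff hb').2 h.symm, ← map_div₀]; exact isAlgebraic_algebraMap _) ht

end Pencil

section GenericPencils

open Matrix

/-- For each `i` the generic vector `w i` is orthogonal to the two parallel vectors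
`C i x - D i y` and `E i x - F i y`, whose ratio `c i` is transcendental. -/
structure IsGenericPencilFamily {k L ι κ : Type*} [Field k] [Field L] [Algebra k L]
    [Fintype κ] [DecidableEq κ] (C D E F : ι → Matrix κ κ k) (x y : κ → L) (c : ι → L)
    (w : ι → κ → L) : Prop where
  algebraicIndependent : AlgebraicIndependent k fun ij : ι × κ => w ij.1 ij.2
  det_ne_zero : ∀ i, (C i).det ≠ 0
  transcendental : ∀ i, Transcendental k (c i)
  ne_zero : ∀ i, (C i).act x - (D i).act y ≠ 0
  eq_smul : ∀ i, (C i).act x - (D i).act y = c i • ((E i).act x - (F i).act y)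
  sum_eq_zero : ∀ i, ∑ j, w i j * ((C i).act x - (D i).act y) j = 0

namespace IsGenericPencilFamily

variable {k L ι κ : Type*} [Field k] [Field L] [Algebra k L] [Fintype κ] [DecidableEq κ]
  {C D E F : ι → Matrix κ κ k} {x y : κ → L}
  {c : ι → L} {w : ι → κ → L}

theorem exists_parametrization (H : IsGenericPencilFamily C D E F x y c w)
    {T : Set L} {i : ι} (hi : c i ∈ algCl k T) :
    ∃ M : Matrix κ κ (algCl k T), x = M.act y ∧
      ((C i).map (algebraMap k _) - (⟨c i, hi⟩ : algCl k T) • (E i).map (algebraMap k _)) * M =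
        (D i).map (algebraMap k _) - (⟨c i, hi⟩ : algCl k T) • (F i).map (algebraMap k _) := by
  refine exists_pencil_parametrization (H.det_ne_zero i) ?_ (H.eq_smul i)
  have h := H.transcendental i
  rwa [← transcendental_algebraMap_iff (R := k) (S := algCl k T) (A := L)
    (FaithfulSMul.algebraMap_injective _ _)]

variable [Fintype ι] [DecidableEq ι] [DecidableEq L]

theorem card_add_one_le (H : IsGenericPencilFamily C D E F x y c w) {T : Finset L} {i : ι}
    (hi : c i ∈ algCl k (T : Set L)) :
    Fintype.card ι + 1 ≤ T.card + Module.finrank (algCl k (T : Set L))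
      (Submodule.span (algCl k (T : Set L)) (Set.range y)) := by
  obtain ⟨M, hM, -⟩ := H.exists_parametrization hi
  have hy : y ≠ 0 := by
    rintro rfl
    rw [act_zero] at hM
    apply H.ne_zero i
    rw [hM, act_zero, act_zero, sub_zero]
  refine card_add_one_le_of_mem_span H.algebraicIndependent H.ne_zero H.sum_eq_zero T Finset.univ
    (K := algCl k (T : Set L)) (fun a => a.2) hy fun i _ => Or.inr ⟨1, one_ne_zero, fun j => ?_⟩
  rw [one_mul, act_sub_act_eq hM]
  exact act_mem_span _ _ _

theorem linearIndependent (H : IsGenericPencilFamily C D E F x y c w)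
    (hcard : Fintype.card ι = Fintype.card κ) (i : ι) :
    LinearIndependent (algCl k {c i}) y := by
  have := H.card_add_one_le (T := {c i}) (i := i) (by simpa using subset_algCl _ (by simp))
  rw [Finset.coe_singleton, Finset.card_singleton] at this
  rw [linearIndependent_iff_card_le_finrank_span, Set.finrank]
  omega

theorem mem_algCl_or_projMem (H : IsGenericPencilFamily C D E F x y c w)
    (hcard : Fintype.card ι = Fintype.card κ) (i j : ι) :
    c j ∈ algCl k {c i} ∨ ProjMem k {c i} ((C j).act x - (D j).act y) := by
  by_cases hj : c j ∈ algCl k {c i}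
  · exact Or.inl hj
  right
  have hi : c i ∈ algCl k {c i} := subset_algCl _ (by simp)
  obtain ⟨M, hM, -⟩ := H.exists_parametrization hi
  have hle : algCl k {c i} ≤ algCl k ((({c i, c j} : Finset L)) : Set L) :=
    algCl_mono (by simp)
  have hcd := H.card_add_one_le (T := {c i, c j}) (i := i) (hle hi)
  have hne : c i ≠ c j := fun h => hj (h ▸ hi)
  rw [Finset.card_pair hne] at hcd
  obtain ⟨b, s, hs, h⟩ := exists_column_of_singular_pencil (K := algCl k {c i})
    (K' := algCl k ((({c i, c j} : Finset L)) : Set L)) (c := c j) (y := y)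
    (N := (C j).map (algebraMap k _) * M - (D j).map (algebraMap k _))
    (N' := (E j).map (algebraMap k _) * M - (F j).map (algebraMap k _))
    (fun a ha => ⟨⟨a, mem_algCl_of_isAlgebraic ha⟩, rfl⟩)
    (by rintro _ ⟨a, rfl⟩; exact ⟨⟨a, hle a.2⟩, rfl⟩)
    (by rintro ⟨a, ha⟩; exact hj (ha ▸ a.2))
    ⟨⟨c j, subset_algCl _ (by simp)⟩, rfl⟩ (by omega)
    (by rw [← act_sub_act_eq hM, ← act_sub_act_eq hM]; exact H.eq_smul j)
    (by rw [← act_sub_act_eq hM]; exact H.ne_zero j)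
  refine ⟨s, hs, fun a => ?_⟩
  have := h a
  rw [← act_sub_act_eq hM] at this
  rw [this]
  exact Subtype.prop _

theorem det_base_ne_zero (H : IsGenericPencilFamily C D E F x y c w)
    (hcard : Fintype.card ι = Fintype.card κ) (i : ι) :
    (E i * ((C i)⁻¹ * D i) - F i).det ≠ 0 := by
  intro hdet
  obtain ⟨y₀, hy₀, hΔ⟩ := Matrix.exists_mulVec_eq_zero_iff.2 hdet
  set x₀ := ((C i)⁻¹ * D i) *ᵥ y₀ with hx₀
  have hE : E i *ᵥ x₀ = F i *ᵥ y₀ := by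
    rw [← sub_eq_zero, hx₀, mulVec_mulVec, ← sub_mulVec, hΔ]
  have hC : C i *ᵥ x₀ = D i *ᵥ y₀ := by
    rw [hx₀, mulVec_mulVec, ← mul_assoc, mul_nonsing_inv _ (H.det_ne_zero i).isUnit, one_mul]
  have hi : c i ∈ algCl k {c i} := subset_algCl _ (by simp)
  obtain ⟨M, hM, hM'⟩ := H.exists_parametrization hi
  have hlin := H.linearIndependent hcard i
  have hci : Transcendental k (⟨c i, hi⟩ : algCl k {c i}) := by
    have h := H.transcendental i
    rwa [← transcendental_algebraMap_iff (R := k) (S := algCl k {c i}) (A := L)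
      (FaithfulSMul.algebraMap_injective _ _)]
  have hpen : ∀ (A B : Matrix κ κ k) (t : algCl k {c i}) (v : κ → k),
      (A.map (algebraMap k (algCl k {c i})) - t • B.map (algebraMap k (algCl k {c i}))) *ᵥ
        (algebraMap k (algCl k {c i}) ∘ v) =
        algebraMap k (algCl k {c i}) ∘ (A *ᵥ v) - t • algebraMap k (algCl k {c i}) ∘ (B *ᵥ v) := by
    intro A B t v
    rw [sub_mulVec, smul_mulVec]
    congr 1
    · funext a; exact (RingHom.map_mulVec (algebraMap k (algCl k {c i})) A v a).symm
    · congr 1; funext a; exact (RingHom.map_mulVec (algebraMap k (algCl k {c i})) B v a).symm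
  have hMy : M *ᵥ (algebraMap k (algCl k {c i}) ∘ y₀) = algebraMap k (algCl k {c i}) ∘ x₀ := by
    apply Matrix.mulVec_injective_of_isUnit
      ((isUnit_iff_isUnit_det _).2 (det_pencil_ne_zero (E := E i) (H.det_ne_zero i) hci).isUnit)
    rw [mulVec_mulVec, hM', hpen, hpen, hE, hC]
  have hall : ∀ j, c j ∈ algCl k {c i} → C j *ᵥ x₀ = D j *ᵥ y₀ := by
    intro j hj
    have h1 := pencil_matrix_eq (K := algCl k {c i}) (c := ⟨c j, hj⟩) hlin hM (H.eq_smul j)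
    have h2 := congrArg (· *ᵥ (algebraMap k (algCl k {c i}) ∘ y₀)) h1
    simp only [← mulVec_mulVec, hMy] at h2
    rw [hpen, hpen] at h2
    funext a
    have h3 := congrFun h2 a
    simp only [Pi.sub_apply, Pi.smul_apply, Function.comp_apply, smul_eq_mul] at h3
    rw [← sub_eq_zero]
    refine eq_zero_of_algebraMap_eq_mul (b := (E j *ᵥ x₀) a - (F j *ᵥ y₀) a)
      (t := (⟨c j, hj⟩ : algCl k {c i})) ?_ ?_
    · have h := H.transcendental j
      rwa [← transcendental_algebraMap_iff (R := k) (S := algCl k {c i}) (A := L)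
        (FaithfulSMul.algebraMap_injective _ _)]
    · rw [map_sub, map_sub]
      linear_combination h3
  obtain ⟨a₀, ha₀⟩ : ∃ a, y₀ a ≠ 0 := by
    by_contra! h
    exact hy₀ (funext h)
  have ha₀' : algebraMap k L (y₀ a₀) ≠ 0 := by simpa using ha₀
  set τ : L := y a₀ / algebraMap k L (y₀ a₀) with hτ
  set y' : κ → L := y - τ • (algebraMap k L ∘ y₀) with hy'
  set x' : κ → L := x - τ • (algebraMap k L ∘ x₀) with hx'
  have hact : ∀ (A : Matrix κ κ k) (v : κ → k),
      A.act (algebraMap k L ∘ v) = algebraMap k L ∘ (A *ᵥ v) := by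
    intro A v
    funext a
    simp [act, mulVec, dotProduct, Algebra.smul_def]
  have hxM : x' = M.act y' := by
    rw [hx', hy', act_sub, act_smul, ← hM]
    congr 2
    funext a
    have := congrArg (algebraMap (algCl k {c i}) L) (congrFun hMy a)
    simp only [mulVec, dotProduct, map_sum, map_mul, Function.comp_apply,
      ← IsScalarTower.algebraMap_apply] at this
    simp only [act, Algebra.smul_def, Function.comp_apply]
    exact this.symm
  have hu : ∀ j, c j ∈ algCl k {c i} → (C j).act x - (D j).act y = (C j).act x' - (D j).act y' := by
    intro j hj
    rw [hx', hy', act_sub, act_sub, act_smul, act_smul, hact, hact, hall j hj]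
    abel
  have hy'0 : y' ≠ 0 := by
    intro h0
    rw [h0, act_zero] at hxM
    apply H.ne_zero i
    rw [hu i hi, hxM, h0, act_zero, act_zero, sub_zero]
  have hrank := finrank_span_add_le (K := algCl k {c i}) (κ := Unit) (z := y')
    (v := fun _ => Pi.single a₀ 1)
    (by rw [linearIndependent_unique_iff]; intro h; simpa using congrFun h a₀)
    (by
      intro _
      rw [Finset.sum_eq_single a₀]
      · simp [hy', hτ, ha₀]
      · intro b _ hb
        simp [hb]
      · simp)
  have := card_add_one_le_of_mem_span H.algebraicIndependent H.ne_zero H.sum_eq_zero {c i}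
    Finset.univ (K := algCl k {c i}) (by simp) hy'0 fun j _ => by
      rcases H.mem_algCl_or_projMem hcard i j with hj | hj
      · refine Or.inr ⟨1, one_ne_zero, fun a => ?_⟩
        rw [one_mul, hu j hj, act_sub_act_eq hxM]
        exact act_mem_span _ _ _
      · left
        simpa using hj
  simp only [Finset.card_univ, Finset.card_singleton, Fintype.card_unit] at this hrank
  omega

end IsGenericPencilFamily

end GenericPencils

namespace IsGenericPencilFamily

open Matrix

variable {k L ι κ : Type*} [Field k] [Field L] [Algebra k L] [Fintype ι] [Fintype κ]
  [DecidableEq ι] [DecidableEq κ] [DecidableEq L] {C D E F : ι → Matrix κ κ k} {x y : κ → L}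
  {c : ι → L} {w : ι → κ → L}

/-- In the square case the parameters `c j` cannot all be algebraic over one of them. -/
theorem exists_notMem_algCl (H : IsGenericPencilFamily C D E F x y c w)
    (hcard : Fintype.card ι = Fintype.card κ) (i : ι) : ∃ j, c j ∉ algCl k {c i} := by
  by_contra! hall
  have hi : c i ∈ algCl k {c i} := subset_algCl _ (by simp)
  set Δ := E i * ((C i)⁻¹ * D i) - F i with hΔ
  have hΔu : IsUnit Δ.det := (H.det_base_ne_zero hcard i).isUnit
  have hCu : IsUnit (C i).det := (H.det_ne_zero i).isUnit
  set e := (E i).act x - (F i).act y with he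
  have hx : x = ((C i)⁻¹ * D i).act y + c i • (C i)⁻¹.act e := by
    have h := congrArg (C i)⁻¹.act (H.eq_smul i)
    rw [act_sub, ← act_mul, nonsing_inv_mul _ hCu, one_act, act_smul, ← act_mul] at h
    rw [← he] at h
    rw [← h]
    abel
  have hy : y = Δ⁻¹.act e + c i • (-(Δ⁻¹ * E i * (C i)⁻¹)).act e := by
    have h : e = Δ.act y + c i • (E i * (C i)⁻¹).act e := by
      conv_lhs => rw [he, hx]
      rw [act_add, act_smul, ← act_mul, ← act_mul, hΔ, sub_act]
      abel
    have h2 := congrArg Δ⁻¹.act h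
    rw [act_add, ← act_mul, nonsing_inv_mul _ hΔu, one_act, act_smul, ← act_mul] at h2
    rw [h2, neg_act, mul_assoc]
    simp
  set P₁ := Δ⁻¹
  set P₂ := -(Δ⁻¹ * E i * (C i)⁻¹)
  have hx' : x = ((C i)⁻¹ * D i * P₁).act e +
      c i • ((C i)⁻¹ * D i * P₂ + (C i)⁻¹).act e := by
    conv_lhs => rw [hx, hy]
    rw [act_add, act_smul, add_act, ← act_mul, ← act_mul, smul_add]
    abel
  set R₁ := (C i)⁻¹ * D i * P₁
  set R₂ := (C i)⁻¹ * D i * P₂ + (C i)⁻¹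
  have hST : ∀ A B : Matrix κ κ k, A.act x - B.act y =
      (A * R₁ - B * P₁).act e + c i • (A * R₂ - B * P₂).act e := by
    intro A B
    conv_lhs => rw [hx', hy]
    rw [act_add, act_add, act_smul, act_smul, sub_act, sub_act, act_mul A, act_mul B, act_mul A,
      act_mul B, smul_sub]
    abel
  have hle : Submodule.span (algCl k {c i}) (Set.range y) ≤
      Submodule.span (algCl k {c i}) (Set.range e) := by
    rw [Submodule.span_le]
    rintro _ ⟨a, rfl⟩
    have h : y = (P₁.map (algebraMap k (algCl k {c i})) +
        (⟨c i, hi⟩ : algCl k {c i}) • P₂.map (algebraMap k (algCl k {c i}))).act e := by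
      rw [add_act, smul_act, map_algebraMap_act, map_algebraMap_act]
      exact hy
    rw [h]
    exact act_mem_span _ _ _
  have hlin : LinearIndependent (algCl k {c i}) e := by
    have h1 := H.linearIndependent hcard i
    rw [linearIndependent_iff_card_le_finrank_span] at h1 ⊢
    have := FiniteDimensional.span_of_finite (algCl k {c i}) (Set.finite_range e)
    exact h1.trans (Submodule.finrank_mono hle)
  have hentry : ∀ j, ∀ a b, algebraMap k L ((C j * R₁ - D j * P₁) a b) +
      c i * algebraMap k L ((C j * R₂ - D j * P₂) a b) =
      c j * (algebraMap k L ((E j * R₁ - F j * P₁) a b) +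
      c i * algebraMap k L ((E j * R₂ - F j * P₂) a b)) := by
    intro j a b
    have h := H.eq_smul j
    rw [hST, hST] at h
    have h2 := eq_of_act_eq_act (R := algCl k {c i})
      (M := (C j * R₁ - D j * P₁).map (algebraMap k (algCl k {c i})) +
        (⟨c i, hi⟩ : algCl k {c i}) • (C j * R₂ - D j * P₂).map (algebraMap k (algCl k {c i})))
      (N := (⟨c j, hall j⟩ : algCl k {c i}) •
        ((E j * R₁ - F j * P₁).map (algebraMap k (algCl k {c i})) +
        (⟨c i, hi⟩ : algCl k {c i}) • (E j * R₂ - F j * P₂).map (algebraMap k (algCl k {c i}))))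
      hlin (by
        rw [smul_act, add_act, smul_act, add_act, smul_act, map_algebraMap_act, map_algebraMap_act,
          map_algebraMap_act, map_algebraMap_act]
        exact h)
    exact congrArg (algebraMap (algCl k {c i}) L) (congrFun (congrFun h2 a) b)
  have he0 : e ≠ 0 := by
    intro h0
    apply H.ne_zero i
    rw [H.eq_smul i, ← he, h0, smul_zero]
  have := card_add_one_le_of_mem_span H.algebraicIndependent H.ne_zero H.sum_eq_zero ∅
    Finset.univ (K := k) (fun a => algebraMap_mem _ a) he0 fun j _ => by
      right
      set S := C j * R₁ - D j * P₁ with hS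
      set T := C j * R₂ - D j * P₂ with hT
      have hprop : ∀ a b a' b', S a b * T a' b' = S a' b' * T a b := fun a b a' b' =>
        mul_eq_mul_of_transcendental_ratio (H.transcendental i) (H.transcendental j)
          (hentry j a b) (hentry j a' b')
      have hu : (C j).act x - (D j).act y = S.act e + c i • T.act e := hST _ _
      have hX : ∀ a b, algebraMap k L (S a b) + c i * algebraMap k L (T a b) = 0 →
          S a b = 0 ∧ T a b = 0 := by
        intro a b h
        have h1 : S a b = 0 := eq_zero_of_algebraMap_eq_mul (b := -T a b) (H.transcendental i)
          (by rw [map_neg]; linear_combination h)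
        refine ⟨h1, ?_⟩
        rw [h1, map_zero, zero_add, mul_eq_zero] at h
        have := h.resolve_left fun h => H.transcendental i (h ▸ isAlgebraic_zero)
        simpa using this
      obtain ⟨a₀, b₀, h₀⟩ : ∃ a b, ¬ (S a b = 0 ∧ T a b = 0) := by
        by_contra! h
        apply H.ne_zero j
        rw [hu]
        funext a
        simp [act, fun a b => (h a b).1, fun a b => (h a b).2]
      set X := algebraMap k L (S a₀ b₀) + c i * algebraMap k L (T a₀ b₀) with hXd
      have hX0 : X ≠ 0 := fun h => h₀ (hX _ _ h)
      have hW : ∃ W : Matrix κ κ k, ∀ a b, algebraMap k L (S a b) + c i * algebraMap k L (T a b) =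
          X * algebraMap k L (W a b) := by
        by_cases hS0 : S a₀ b₀ = 0
        · have hT0 : T a₀ b₀ ≠ 0 := fun h => h₀ ⟨hS0, h⟩
          have hT0' : algebraMap k L (T a₀ b₀) ≠ 0 := by simpa using hT0
          refine ⟨fun a b => T a b / T a₀ b₀, fun a b => ?_⟩
          have h1 : S a b = 0 := by
            have := hprop a b a₀ b₀
            rw [hS0, zero_mul] at this
            exact (mul_eq_zero.1 this).resolve_right hT0
          rw [hXd, hS0, h1, map_div₀, map_zero, zero_add, zero_add]
          field_simp
        · have hS0' : algebraMap k L (S a₀ b₀) ≠ 0 := by simpa using hS0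
          refine ⟨fun a b => S a b / S a₀ b₀, fun a b => ?_⟩
          have h1 := congrArg (algebraMap k L) (hprop a b a₀ b₀)
          rw [map_mul, map_mul] at h1
          rw [hXd, map_div₀]
          field_simp
          linear_combination -c i * h1
      obtain ⟨W, hW⟩ := hW
      refine ⟨X⁻¹, inv_ne_zero hX0, fun a => ?_⟩
      have h3 : X⁻¹ * ((C j).act x - (D j).act y) a = W.act e a := by
        rw [hu, inv_mul_eq_iff_eq_mul₀ hX0, Pi.add_apply, Pi.smul_apply, smul_eq_mul]
        simp only [act, Algebra.smul_def]
        rw [Finset.mul_sum, Finset.mul_sum, ← Finset.sum_add_distrib]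
        refine Finset.sum_congr rfl fun b _ => ?_
        linear_combination e b * hW a b
      rw [h3]
      exact act_mem_span _ _ _
  have h4 := finrank_range_le_card (R := k) e
  rw [Set.finrank] at h4
  simp only [Finset.card_univ, Finset.card_empty] at this
  omega

theorem card_le_two (H : IsGenericPencilFamily C D E F x y c w)
    (hcard : Fintype.card ι = Fintype.card κ) : Fintype.card ι ≤ 2 := by
  by_contra! h3
  have hone : ∀ i j l, j ≠ l → c j ∉ algCl k {c i} → c l ∈ algCl k {c i} := by
    intro i j l hjl hj
    by_contra hl
    have := card_le_of_projMem H.algebraicIndependent H.ne_zero H.sum_eq_zero {c i} {j, l} (by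
      intro m hm
      rw [Finset.coe_singleton]
      rcases Finset.mem_insert.1 hm with rfl | hm
      · exact (H.mem_algCl_or_projMem hcard i m).resolve_left hj
      · rw [Finset.mem_singleton] at hm
        subst hm
        exact (H.mem_algCl_or_projMem hcard i m).resolve_left hl)
    rw [Finset.card_pair hjl, Finset.card_singleton] at this
    omega
  have hswap : ∀ i j, c j ∈ algCl k {c i} → c i ∈ algCl k {c j} := by
    intro i j hj
    have := mem_algCl_exchange (k := k) (T := ∅) (a := c j) (b := c i) (by
      intro h
      exact H.transcendental j (mem_algCl_empty.1 h)) (by simpa using hj)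
    simpa using this
  obtain ⟨i⟩ : Nonempty ι := Fintype.card_pos_iff.1 (by omega)
  obtain ⟨j, hj⟩ := H.exists_notMem_algCl hcard i
  have hij : i ≠ j := by
    rintro rfl
    exact hj (subset_algCl _ (by simp))
  obtain ⟨l, -, hl⟩ : ∃ l ∈ (Finset.univ : Finset ι), l ∉ ({i, j} : Finset ι) :=
    Finset.exists_mem_notMem_of_card_lt_card
      ((Finset.card_pair hij).trans_lt (by rwa [Finset.card_univ]))
  simp only [Finset.mem_insert, Finset.mem_singleton, not_or] at hl
  have h1 : c l ∈ algCl k {c i} := hone i j l (Ne.symm hl.2) hj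
  have h2 : c i ∉ algCl k {c j} := fun h => hj (hswap j i h)
  have h4 : c l ∈ algCl k {c j} := hone j i l (Ne.symm hl.1) h2
  refine h2 (algCl_le_of_subset ?_ (hswap i l h1))
  simpa using h4

end IsGenericPencilFamily

section Plane

open Matrix

theorem eq_rotation_of_det_eq_one {P : Matrix (Fin 2) (Fin 2) ℝ}
    (hP : P ∈ orthogonalGroup (Fin 2) ℝ) (h : P.det = 1) :
    ∃ a b : ℝ, a ^ 2 + b ^ 2 = 1 ∧ P = !![a, -b; b, a] := by
  rw [mem_orthogonalGroup_iff] at hP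
  have h00 := congrFun (congrFun hP 0) 0
  have h01 := congrFun (congrFun hP 0) 1
  simp only [mul_apply, Fin.sum_univ_two, transpose_apply, one_apply_eq, ne_eq,
    zero_ne_one, not_false_eq_true, one_apply_ne] at h00 h01
  rw [det_fin_two] at h
  have h1 : P 1 1 = P 0 0 := by linear_combination (-P 1 1) * h00 + P 0 1 * h01 + P 0 0 * h
  have h2 : P 0 1 = -P 1 0 := by linear_combination (-P 1 0) * h00 + P 0 0 * h01 - P 0 1 * h
  refine ⟨P 0 0, P 1 0, by rw [← h00, h2]; ring, ?_⟩
  ext i j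
  fin_cases i <;> fin_cases j <;> simp [h1, h2]

theorem eq_reflection_of_det_eq_neg_one {P : Matrix (Fin 2) (Fin 2) ℝ}
    (hP : P ∈ orthogonalGroup (Fin 2) ℝ) (h : P.det = -1) :
    ∃ a b : ℝ, a ^ 2 + b ^ 2 = 1 ∧ P = !![a, b; b, -a] := by
  rw [mem_orthogonalGroup_iff] at hP
  have h00 := congrFun (congrFun hP 0) 0
  have h01 := congrFun (congrFun hP 0) 1
  simp only [mul_apply, Fin.sum_univ_two, transpose_apply, one_apply_eq, ne_eq,
    zero_ne_one, not_false_eq_true, one_apply_ne] at h00 h01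
  rw [det_fin_two] at h
  have h1 : P 1 1 = -P 0 0 := by linear_combination -P 1 1 * h00 + P 0 1 * h01 + P 0 0 * h
  have h2 : P 0 1 = P 1 0 := by linear_combination P 1 0 * h00 - P 0 0 * h01 + P 0 1 * h
  refine ⟨P 0 0, P 1 0, by rw [← h00, h2]; ring, ?_⟩
  ext i j
  fin_cases i <;> fin_cases j <;> simp [h1, h2]

theorem det_eq_one_or_neg_one {κ : Type*} [Fintype κ] [DecidableEq κ] {P : Matrix κ κ ℝ}
    (hP : P ∈ orthogonalGroup κ ℝ) : P.det = 1 ∨ P.det = -1 := by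
  rw [mem_orthogonalGroup_iff] at hP
  have := congrArg det hP
  rw [det_mul, det_transpose, det_one] at this
  exact mul_self_eq_one_iff.1 this

/-- If both `1 - c A` and `1 - c B` are similitudes then so is their quotient. -/
theorem eq_similitude_of_mul_eq {K : Type*} [Field K] {α β σ τ : K} (h : α ^ 2 + β ^ 2 ≠ 0)
    {M : Matrix (Fin 2) (Fin 2) K} (hM : !![α, -β; β, α] * M = !![σ, -τ; τ, σ]) :
    M 1 1 = M 0 0 ∧ M 0 1 = -M 1 0 := by
  have h00 := congrFun (congrFun hM 0) 0
  have h01 := congrFun (congrFun hM 0) 1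
  have h10 := congrFun (congrFun hM 1) 0
  have h11 := congrFun (congrFun hM 1) 1
  simp only [mul_apply, Fin.sum_univ_two, of_apply, cons_val', cons_val_zero, cons_val_fin_one,
    cons_val_one] at h00 h01 h10 h11
  have e1 : α * (M 0 0 - M 1 1) - β * (M 0 1 + M 1 0) = 0 := by linear_combination h00 - h11
  have e2 : α * (M 0 1 + M 1 0) + β * (M 0 0 - M 1 1) = 0 := by linear_combination h01 + h10
  constructor
  · have : (α ^ 2 + β ^ 2) * (M 0 0 - M 1 1) = 0 := by linear_combination α * e1 + β * e2
    linear_combination -(mul_eq_zero.1 this).resolve_left h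
  · have : (α ^ 2 + β ^ 2) * (M 0 1 + M 1 0) = 0 := by linear_combination α * e2 - β * e1
    linear_combination (mul_eq_zero.1 this).resolve_left h

namespace IsGenericPencilFamily

variable {L ι : Type*} [Field L] [LinearOrder L] [IsStrictOrderedRing L] [Algebra ℝ L]
  [Fintype ι] [DecidableEq ι] {C D E F : ι → Matrix (Fin 2) (Fin 2) ℝ} {x y : Fin 2 → L}
  {c : ι → L} {w : ι → Fin 2 → L}

theorem exists_similitude (H : IsGenericPencilFamily C D E F x y c w) (hcard : Fintype.card ι = 2)
    {i : ι} (hC : C i = 1) (hD : D i = 1) (hE : E i ∈ orthogonalGroup (Fin 2) ℝ)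
    (hE1 : (E i).det = 1) (hF : F i ∈ orthogonalGroup (Fin 2) ℝ) :
    ∃ p q : algCl ℝ {c i}, x = (!![p, -q; q, p]).act y := by
  have hdet := H.det_base_ne_zero (by simpa using hcard) i
  obtain ⟨M, hM, hM'⟩ := H.exists_parametrization (T := {c i}) (i := i) (subset_algCl _ (by simp))
  have hne := det_pencil_ne_zero (H.det_ne_zero i) (H.transcendental i) (E := E i)
  rw [hC, hD] at hM' hdet
  rw [hC] at hne
  rw [inv_one, one_mul, mul_one] at hdet
  obtain ⟨a, b, hab, hA⟩ := eq_rotation_of_det_eq_one hE hE1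
  have hF1 : (F i).det = 1 := by
    refine (det_eq_one_or_neg_one hF).resolve_right fun h => hdet ?_
    obtain ⟨s, t, hst, hB⟩ := eq_reflection_of_det_eq_neg_one hF h
    rw [hA, hB, det_fin_two]
    simp only [Matrix.sub_apply, of_apply, cons_val', cons_val_zero, cons_val_fin_one, cons_val_one]
    linear_combination hab - hst
  obtain ⟨s, t, hst, hB⟩ := eq_rotation_of_det_eq_one hF hF1
  rw [hA, hB] at hM'
  rw [hA] at hne
  set f := algebraMap ℝ (algCl ℝ {c i})
  set c' : algCl ℝ {c i} := ⟨c i, subset_algCl _ (by simp)⟩ with hc'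
  have hsim := eq_similitude_of_mul_eq (α := 1 - c' * f a) (β := -(c' * f b))
    (σ := 1 - c' * f s) (τ := -(c' * f t)) (M := M) (by
      intro h0
      apply hne
      rw [det_fin_two]
      have := congrArg (algebraMap (algCl ℝ {c i}) L) h0
      simp only [map_add, map_pow, map_sub, map_neg, map_mul, map_one, map_zero, f,
        ← IsScalarTower.algebraMap_apply] at this
      simp only [Matrix.sub_apply, map_apply, Matrix.smul_apply, one_apply_eq, of_apply, cons_val',
        cons_val_zero, cons_val_fin_one, cons_val_one, smul_eq_mul, map_neg, map_one, map_zero,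
        ne_eq, zero_ne_one, one_ne_zero, not_false_eq_true, one_apply_ne]
      simp only [hc', IntermediateField.algebraMap_apply] at this
      linear_combination this) (by
      convert hM' using 1
      · congr 1
        ext i j
        fin_cases i <;> fin_cases j <;> simp
      · ext i j
        fin_cases i <;> fin_cases j <;> simp)
  refine ⟨M 0 0, M 1 0, ?_⟩
  rw [hM]
  congr 1
  ext i j
  fin_cases i <;> fin_cases j <;> simp [hsim.1, hsim.2]

end IsGenericPencilFamily

end Plane

section PlaneContradiction

open Matrix

theorem minor_eq_of_mul_eq_mul {K κ : Type*} [Field K] {e : Fin 2 → K} (he : e ≠ 0)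
    {N N' : Matrix (Fin 2) κ K} (h : ∀ b, e 1 * N 0 b = e 0 * N 1 b)
    (h' : ∀ b, e 1 * N' 0 b = e 0 * N' 1 b) (b b' : κ) :
    N 0 b * N' 1 b' = N 1 b * N' 0 b' := by
  by_cases h0 : e 0 = 0
  · have h1 : e 1 ≠ 0 := by
      intro h1
      apply he
      ext i
      fin_cases i <;> assumption
    apply mul_left_cancel₀ h1
    linear_combination N' 1 b' * h b - N 1 b * h' b'
  · apply mul_left_cancel₀ h0
    linear_combination N' 0 b' * h b - N 0 b * h' b'

theorem det_eq_neg_det_of_minor_eq {K : Type*} [Field K]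
    (hsq : ∀ X Y : K, X ^ 2 + Y ^ 2 = 0 → X = 0 ∧ Y = 0) (f : ℝ →+* K) {p q : K}
    {P Q : Matrix (Fin 2) (Fin 2) ℝ} (hP : P ∈ orthogonalGroup (Fin 2) ℝ)
    (hQ : Q ∈ orthogonalGroup (Fin 2) ℝ) (hN : P.map f * !![p, -q; q, p] - Q.map f ≠ 0)
    (hmin : (P.map f * !![p, -q; q, p] - Q.map f) 0 0 * (P.map f * !![p, -q; q, p] - Q.map f) 1 1 =
      (P.map f * !![p, -q; q, p] - Q.map f) 1 0 * (P.map f * !![p, -q; q, p] - Q.map f) 0 1) :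
    P.det = -Q.det := by
  rcases det_eq_one_or_neg_one hP with hP1 | hP1 <;>
    rcases det_eq_one_or_neg_one hQ with hQ1 | hQ1
  · exfalso
    obtain ⟨a, b, hab, rfl⟩ := eq_rotation_of_det_eq_one hP hP1
    obtain ⟨s, t, hst, rfl⟩ := eq_rotation_of_det_eq_one hQ hQ1
    simp [mul_apply, Fin.sum_univ_two] at hmin
    obtain ⟨h1, h2⟩ := hsq (f a * p - f b * q - f s) (f a * q + f b * p - f t)
      (by linear_combination hmin)
    apply hN
    ext i j
    fin_cases i <;> fin_cases j <;> simp [mul_apply, Fin.sum_univ_two]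
    · linear_combination h1
    · linear_combination -h2
    · linear_combination h2
    · linear_combination h1
  · rw [hP1, hQ1, neg_neg]
  · rw [hP1, hQ1]
  · exfalso
    obtain ⟨a, b, hab, rfl⟩ := eq_reflection_of_det_eq_neg_one hP hP1
    obtain ⟨s, t, hst, rfl⟩ := eq_reflection_of_det_eq_neg_one hQ hQ1
    simp [mul_apply, Fin.sum_univ_two] at hmin
    obtain ⟨h1, h2⟩ := hsq (f a * p + f b * q - f s) (f b * p - f a * q - f t)
      (by linear_combination -hmin)
    apply hN
    ext i j
    fin_cases i <;> fin_cases j <;> simp [mul_apply, Fin.sum_univ_two]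
    · linear_combination h1
    · linear_combination h2
    · linear_combination h2
    · linear_combination -h1

theorem exists_sq_eq_of_minor_eq {K : Type*} [Field K] [CharZero K] (f : ℝ →+* K) {p q : K}
    {P Q P' Q' : Matrix (Fin 2) (Fin 2) ℝ} (hP : P ∈ orthogonalGroup (Fin 2) ℝ)
    (hQ : Q ∈ orthogonalGroup (Fin 2) ℝ) (hP' : P' ∈ orthogonalGroup (Fin 2) ℝ)
    (hQ' : Q' ∈ orthogonalGroup (Fin 2) ℝ) (hP1 : P.det = 1) (hQ1 : Q.det = -1)
    (hP1' : P'.det = -1) (hQ1' : Q'.det = 1)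
    (hmin : (P.map f * !![p, -q; q, p] - Q.map f) 0 0 * (P.map f * !![p, -q; q, p] - Q.map f) 1 1 =
      (P.map f * !![p, -q; q, p] - Q.map f) 1 0 * (P.map f * !![p, -q; q, p] - Q.map f) 0 1)
    (hmin' : ∀ b b', (P.map f * !![p, -q; q, p] - Q.map f) 0 b *
        (P'.map f * !![p, -q; q, p] - Q'.map f) 1 b' =
      (P.map f * !![p, -q; q, p] - Q.map f) 1 b *
        (P'.map f * !![p, -q; q, p] - Q'.map f) 0 b') :
    ∃ r : ℝ, p ^ 2 = f ((1 + r) / 2) ∧ q ^ 2 = f ((1 - r) / 2) := by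
  have m00 := hmin' 0 0
  have m01 := hmin' 0 1
  have m10 := hmin' 1 0
  have m11 := hmin' 1 1
  obtain ⟨a, b, hab, rfl⟩ := eq_rotation_of_det_eq_one hP hP1
  obtain ⟨s, t, hst, rfl⟩ := eq_reflection_of_det_eq_neg_one hQ hQ1
  obtain ⟨a', b', hab', rfl⟩ := eq_reflection_of_det_eq_neg_one hP' hP1'
  obtain ⟨s', t', hst', rfl⟩ := eq_rotation_of_det_eq_one hQ' hQ1'
  clear hmin' hP hQ hP' hQ' hP1 hQ1 hP1' hQ1'
  simp [mul_apply, Fin.sum_univ_two] at m00 m01 m10 m11 hmin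
  have fab := congrArg f hab
  have fst := congrArg f hst
  simp only [map_add, map_pow, map_one] at fab fst
  have hpq : p ^ 2 + q ^ 2 = 1 := by
    linear_combination hmin + fst - (p ^ 2 + q ^ 2) * fab
  have h2 : (2 : K) ≠ 0 := two_ne_zero
  have e1 : f (a * b' - b * a') * (p ^ 2 - q ^ 2) - f (a * a' + b * b') * (2 * p * q) =
      f (t * s' - s * t') := by
    simp only [map_sub, map_add, map_mul]
    apply mul_left_cancel₀ h2
    linear_combination m00 - m11
  have e2 : f (a * a' + b * b') * (p ^ 2 - q ^ 2) + f (a * b' - b * a') * (2 * p * q) =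
      f (s * s' + t * t') := by
    simp only [map_sub, map_add, map_mul]
    apply mul_left_cancel₀ h2
    linear_combination -m01 - m10
  have hXY : f (a * a' + b * b') ^ 2 + f (a * b' - b * a') ^ 2 = 1 := by
    rw [← map_pow, ← map_pow, ← map_add, ← map_one f]
    congr 1
    linear_combination (a' ^ 2 + b' ^ 2) * hab + hab'
  have e3 : p ^ 2 - q ^ 2 =
      f ((a * b' - b * a') * (t * s' - s * t') + (a * a' + b * b') * (s * s' + t * t')) := by
    rw [map_add, map_mul, map_mul, ← e1, ← e2]
    linear_combination (q ^ 2 - p ^ 2) * hXY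
  refine ⟨(a * b' - b * a') * (t * s' - s * t') + (a * a' + b * b') * (s * s' + t * t'), ?_, ?_⟩
  · rw [map_div₀, map_add, map_one, map_ofNat, ← e3]
    field_simp
    linear_combination hpq
  · rw [map_div₀, map_sub, map_one, map_ofNat, ← e3]
    field_simp
    linear_combination hpq

theorem exists_det_eq_or_exists_sq_eq {K L : Type*} [Field K] [CharZero K] [Field L] [Algebra ℝ K]
    [Algebra ℝ L] [Algebra K L] [IsScalarTower ℝ K L]
    (hsq : ∀ X Y : K, X ^ 2 + Y ^ 2 = 0 → X = 0 ∧ Y = 0) {x y u : Fin 2 → L} {p q : K}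
    (hx : x = (!![p, -q; q, p]).act y) (hy : LinearIndependent K y) (hu : u ≠ 0) {s : L}
    (hs : s ≠ 0) {e : Fin 2 → K} (he : ∀ a, algebraMap K L (e a) = s * u a) :
    (∃ ε : ℝ, ∀ P ∈ orthogonalGroup (Fin 2) ℝ, ∀ Q ∈ orthogonalGroup (Fin 2) ℝ,
      ∀ t : L, t ≠ 0 → P.act x - Q.act y = t • u → P.det = ε ∧ Q.det = -ε) ∨
    ∃ r : ℝ, p ^ 2 = algebraMap ℝ K ((1 + r) / 2) ∧ q ^ 2 = algebraMap ℝ K ((1 - r) / 2) := by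
  have he0 : e ≠ 0 := by
    rintro rfl
    apply hu
    funext a
    simpa [hs] using (he a).symm
  have hrow : ∀ P Q : Matrix (Fin 2) (Fin 2) ℝ, ∀ t : L, P.act x - Q.act y = t • u →
      ∀ b, e 1 * (P.map (algebraMap ℝ K) * !![p, -q; q, p] - Q.map (algebraMap ℝ K)) 0 b =
        e 0 * (P.map (algebraMap ℝ K) * !![p, -q; q, p] - Q.map (algebraMap ℝ K)) 1 b := by
    intro P Q t h b
    rw [act_sub_act_eq hx] at h
    generalize P.map (algebraMap ℝ K) * !![p, -q; q, p] - Q.map (algebraMap ℝ K) = N at h ⊢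
    have h0 := congrFun h 0
    have h1 := congrFun h 1
    have hz : ∑ b, (e 1 * N 0 b - e 0 * N 1 b) • y b = 0 := by
      have hsum : e 1 • N.act y 0 - e 0 • N.act y 1 = 0 := by
        rw [h0, h1, Pi.smul_apply, Pi.smul_apply, smul_eq_mul, smul_eq_mul, Algebra.smul_def,
          Algebra.smul_def, he, he]
        ring
      rw [← hsum]
      simp only [act, Finset.smul_sum, sub_smul, mul_smul, Finset.sum_sub_distrib]
    exact sub_eq_zero.1 (Fintype.linearIndependent_iff.1 hy _ hz b)
  have hminor := fun (P Q P' Q' : Matrix (Fin 2) (Fin 2) ℝ) (t t' : L)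
      (h : P.act x - Q.act y = t • u) (h' : P'.act x - Q'.act y = t' • u) =>
    minor_eq_of_mul_eq_mul he0 (hrow P Q t h) (hrow P' Q' t' h')
  have hne : ∀ P Q : Matrix (Fin 2) (Fin 2) ℝ, ∀ t : L, t ≠ 0 → P.act x - Q.act y = t • u →
      P.map (algebraMap ℝ K) * !![p, -q; q, p] - Q.map (algebraMap ℝ K) ≠ 0 := by
    intro P Q t ht h h0
    rw [act_sub_act_eq hx, h0] at h
    apply smul_ne_zero ht hu
    rw [← h]
    funext a
    simp [act]
  have hdet : ∀ P ∈ orthogonalGroup (Fin 2) ℝ, ∀ Q ∈ orthogonalGroup (Fin 2) ℝ,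
      ∀ t : L, t ≠ 0 → P.act x - Q.act y = t • u → P.det = -Q.det := fun P hP Q hQ t ht h =>
    det_eq_neg_det_of_minor_eq hsq _ hP hQ (hne P Q t ht h) (hminor P Q P Q t t h h 0 1)
  by_cases hex : ∃ P ∈ orthogonalGroup (Fin 2) ℝ, ∃ Q ∈ orthogonalGroup (Fin 2) ℝ,
      ∃ t : L, t ≠ 0 ∧ P.act x - Q.act y = t • u ∧ P.det = 1
  swap
  · refine Or.inl ⟨-1, fun P hP Q hQ t ht h => ?_⟩
    have h1 := hdet P hP Q hQ t ht h
    have h2 : P.det = -1 := (det_eq_one_or_neg_one hP).resolve_left fun h3 =>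
      hex ⟨P, hP, Q, hQ, t, ht, h, h3⟩
    exact ⟨h2, by linarith⟩
  obtain ⟨P, hP, Q, hQ, t, ht, h, hP1⟩ := hex
  rw [or_iff_not_imp_right]
  refine fun hr => ⟨1, fun P' hP' Q' hQ' t' ht' h' => ?_⟩
  have h1' := hdet P' hP' Q' hQ' t' ht' h'
  suffices h2 : P'.det = 1 from ⟨h2, by linarith⟩
  refine (det_eq_one_or_neg_one hP').resolve_right fun hP1' => hr ?_
  have hQ1 : Q.det = -1 := by linarith [hdet P hP Q hQ t ht h]
  have hQ1' : Q'.det = 1 := by linarith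
  exact exists_sq_eq_of_minor_eq _ hP hQ hP' hQ' hP1 hQ1 hP1' hQ1'
    (hminor P Q P Q t t h h 0 1) (hminor P Q P' Q' t t' h h')

theorem sq_add_sq_eq_zero_of_intermediateField {k L : Type*} [Field k] [Field L] [LinearOrder L]
    [IsStrictOrderedRing L] [Algebra k L] (K : IntermediateField k L) (X Y : K)
    (h : X ^ 2 + Y ^ 2 = 0) : X = 0 ∧ Y = 0 := by
  have h1 : (X : L) ^ 2 + (Y : L) ^ 2 = 0 := by
    simpa using congrArg (algebraMap K L) h
  have hX : (X : L) ^ 2 = 0 := le_antisymm (by nlinarith [sq_nonneg (Y : L)]) (sq_nonneg _)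
  have hY : (Y : L) ^ 2 = 0 := le_antisymm (by nlinarith [sq_nonneg (X : L)]) (sq_nonneg _)
  exact ⟨Subtype.ext (pow_eq_zero_iff two_ne_zero |>.1 hX),
    Subtype.ext (pow_eq_zero_iff two_ne_zero |>.1 hY)⟩

namespace IsGenericPencilFamily

variable {L ι : Type*} [Field L] [LinearOrder L] [IsStrictOrderedRing L] [Algebra ℝ L]
  [Fintype ι] [DecidableEq ι] {C D E F : ι → Matrix (Fin 2) (Fin 2) ℝ} {x y : Fin 2 → L}
  {c : ι → L} {w : ι → Fin 2 → L}

theorem ne_act_of_algCl_empty (H : IsGenericPencilFamily C D E F x y c w)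
    (hcard : Fintype.card ι = 2) (i : ι) {K : Type*} [Field K] [Algebra ℝ K] [Algebra K L]
    [IsScalarTower ℝ K L] (hK : ∀ a : K, algebraMap K L a ∈ algCl ℝ (∅ : Set L))
    (M : Matrix (Fin 2) (Fin 2) K) : x ≠ M.act y := by
  intro hx
  have hy0 : y ≠ 0 := by
    rintro rfl
    apply H.ne_zero i
    rw [hx, act_zero, act_zero, act_zero, sub_zero]
  have hfin := card_add_one_le_of_mem_span H.algebraicIndependent H.ne_zero H.sum_eq_zero ∅
    Finset.univ (K := K) (by rwa [Finset.coe_empty]) hy0 fun j _ =>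
      Or.inr ⟨1, one_ne_zero, fun a => by
        rw [one_mul, act_sub_act_eq hx]
        exact act_mem_span _ _ _⟩
  have h4 : Module.finrank K (Submodule.span K (Set.range y)) ≤ Fintype.card (Fin 2) :=
    finrank_range_le_card y
  rw [Finset.card_univ, hcard, Finset.card_empty] at hfin
  rw [Fintype.card_fin] at h4
  omega

theorem not_eq_act_of_mem_algCl_empty (H : IsGenericPencilFamily C D E F x y c w)
    (hcard : Fintype.card ι = 2) (i : ι) {p q : L}
    (hp : p ∈ algCl ℝ (∅ : Set L)) (hq : q ∈ algCl ℝ (∅ : Set L)) :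
    x ≠ (!![p, -q; q, p]).act y := by
  have h := H.ne_act_of_algCl_empty hcard i (K := algCl ℝ (∅ : Set L)) (fun a => a.2)
    !![⟨p, hp⟩, -⟨q, hq⟩; ⟨q, hq⟩, ⟨p, hp⟩]
  intro hx
  apply h
  rw [hx]
  funext a
  fin_cases a <;> simp [act, Fin.sum_univ_two, Algebra.smul_def]

theorem exists_det_eq (H : IsGenericPencilFamily C D E F x y c w) (hcard : Fintype.card ι = 2)
    {i : ι} (hC : C i = 1) (hD : D i = 1) (hE : E i ∈ orthogonalGroup (Fin 2) ℝ)
    (hE1 : (E i).det = 1) (hF : F i ∈ orthogonalGroup (Fin 2) ℝ) :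
    ∃ j, ∃ ε : ℝ, ∀ P ∈ orthogonalGroup (Fin 2) ℝ, ∀ Q ∈ orthogonalGroup (Fin 2) ℝ,
      ∀ t : L, t ≠ 0 → P.act x - Q.act y = t • ((C j).act x - (D j).act y) →
        P.det = ε ∧ Q.det = -ε := by
  obtain ⟨j, hj⟩ := H.exists_notMem_algCl (by simpa using hcard) i
  refine ⟨j, ?_⟩
  have hproj := (H.mem_algCl_or_projMem (by simpa using hcard) i j).resolve_left hj
  have hlin := H.linearIndependent (by simpa using hcard) i
  obtain ⟨p, q, hx⟩ := H.exists_similitude hcard hC hD hE hE1 hF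
  have hu := H.ne_zero j
  obtain ⟨s, hs, hsu⟩ := hproj
  refine (exists_det_eq_or_exists_sq_eq (sq_add_sq_eq_zero_of_intermediateField _) hx hlin hu hs
    (e := fun a => ⟨_, hsu a⟩) fun a => rfl).resolve_right ?_
  rintro ⟨r, hpr, hqr⟩
  have halg : ∀ (z : algCl ℝ {c i}) (r : ℝ), z ^ 2 = algebraMap ℝ _ r →
      (z : L) ∈ algCl ℝ (∅ : Set L) := by
    intro z r hz
    refine mem_algCl_empty.2 (IsAlgebraic.of_pow two_pos ?_)
    have h1 := congrArg (algebraMap (algCl ℝ {c i}) L) hz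
    rw [map_pow, ← IsScalarTower.algebraMap_apply] at h1
    rw [IntermediateField.algebraMap_apply] at h1
    rw [h1]
    exact isAlgebraic_algebraMap _
  apply H.not_eq_act_of_mem_algCl_empty hcard i (halg p _ hpr) (halg q _ hqr)
  rw [hx]
  funext a
  fin_cases a <;> simp [act, Fin.sum_univ_two, Algebra.smul_def]

end IsGenericPencilFamily

end PlaneContradiction

section Collisions

open Matrix

theorem finrank_span_add_rank_le {K L ι l : Type*} [Field K] [Field L] [Algebra K L] [Fintype ι]
    [Finite l] {N : Matrix l ι K} {z : ι → L} (h : N.act z = 0) :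
    Module.finrank K (Submodule.span K (Set.range z)) + N.rank ≤ Fintype.card ι := by
  have h1 := (Fintype.linearCombination K z).finrank_range_add_finrank_ker
  rw [Fintype.range_linearCombination, Module.finrank_fintype_fun_eq_card] at h1
  have h2 : Submodule.span K (Set.range N) ≤ (Fintype.linearCombination K z).ker := by
    rw [Submodule.span_le]
    rintro _ ⟨j, rfl⟩
    simpa [Fintype.linearCombination_apply, act] using congrFun h j
  have h3 := Submodule.finrank_mono h2
  have h4 : N.rank = Module.finrank K (Submodule.span K (Set.range N)) :=
    N.rank_eq_finrank_span_row
  omega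

theorem finrank_span_elim_add_rank_le {K L κ : Type*} [Field K] [Field L] [Algebra K L]
    [Fintype κ] [DecidableEq κ] {P Q : Matrix κ κ K} {x y : κ → L} (h : P.act x = Q.act y) :
    Module.finrank K (Submodule.span K (Set.range (Sum.elim x y))) + P.rank ≤
      2 * Fintype.card κ := by
  have h1 : (fromCols P (-Q)).act (Sum.elim x y) = 0 := by
    funext a
    have := congrFun h a
    simp only [act] at this
    simp [act, this]
  have h2 := finrank_span_add_rank_le h1
  have h3 : fromCols P (-Q) * (fromRows 1 0 : Matrix (κ ⊕ κ) κ K) = P := by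
    rw [fromCols_mul_fromRows]
    simp
  have h4 := rank_mul_le_left (fromCols P (-Q)) (fromRows 1 0 : Matrix (κ ⊕ κ) κ K)
  rw [h3] at h4
  rw [Fintype.card_sum] at h2
  omega

theorem act_sub_act_mem_algCl {k L κ : Type*} [Field k] [Field L] [Algebra k L] [Fintype κ]
    {P Q : Matrix κ κ k} {x y : κ → L} {T : Set L} {s : L} (hx : ∀ a, s * x a ∈ algCl k T)
    (hy : ∀ a, s * y a ∈ algCl k T) (a : κ) : s * (P.act x - Q.act y) a ∈ algCl k T := by
  have h : s * (P.act x - Q.act y) a = P.act (s • x) a - Q.act (s • y) a := by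
    rw [act_smul, act_smul]
    simp only [Pi.sub_apply, Pi.smul_apply, smul_eq_mul]
    ring
  rw [h]
  exact sub_mem (sum_mem fun b _ => (algCl k T).smul_mem (hx b))
    (sum_mem fun b _ => (algCl k T).smul_mem (hy b))

/-- A pair `x`, `y` in different orbits whose images are not separated by the generic vectors `w`,
over an extension of `ℝ`. -/
structure IsGenericCollision {d p : ℕ} {G L : Type*} [Group G] [Field L] [Algebra ℝ L]
    (O : G →* Matrix (Fin d) (Fin d) ℝ) (r : G → ℕ) (n γ : ℕ) {m : Fin p → ℕ}
    (a b : ∀ i, Fin (m i) → G) (x y : Fin d → L) (w : Fin p → Fin d → L) : Prop where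
  mem_orthogonalGroup : ∀ g, O g ∈ orthogonalGroup (Fin d) ℝ
  le_rank : ∀ g (c : ℝ), r g ≤ (O g - c • 1).rank
  exists_le : ∀ S : Finset G, 1 ∉ S → n ≤ S.card + 1 → ∃ g ∈ S, γ ≤ r g
  le_dim : γ ≤ d
  two_mul_le : 2 * d ≤ p + γ
  le_two_mul : p ≤ 2 * d
  eq_of_lt : ∀ i : Fin p, (i : ℕ) < 2 * d - p → m i = n
  pos : ∀ i, 0 < m i
  injective : ∀ i, Function.Injective (a i)
  ne_zero : ∀ g h, (O g).act x - (O h).act y ≠ 0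
  algebraicIndependent : AlgebraicIndependent ℝ fun ij : Fin p × Fin d => w ij.1 ij.2
  sum_eq_zero : ∀ i j, ∑ k, w i k * ((O (a i j)).act x - (O (b i j)).act y) k = 0

namespace IsGenericCollision

variable {d p n γ : ℕ} {G L : Type*} [Group G] [Field L] [Algebra ℝ L]
  {O : G →* Matrix (Fin d) (Fin d) ℝ} {r : G → ℕ} {m : Fin p → ℕ} {a b : ∀ i, Fin (m i) → G}
  {x y : Fin d → L} {w : Fin p → Fin d → L}

theorem isUnit_det (H : IsGenericCollision O r n γ a b x y w) (g : G) : IsUnit (O g).det := by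
  rcases det_eq_one_or_neg_one (H.mem_orthogonalGroup g) with h | h <;> rw [h] <;> simp

theorem two_mul_le_card_add_card [DecidableEq L] (H : IsGenericCollision O r n γ a b x y w)
    {I : Finset (Fin p)}
    (hI : ∀ i : Fin p, (i : ℕ) < 2 * d - p → i ∉ I → ∃ j j', ∀ c : L,
      (O (a i j)).act x - (O (b i j)).act y ≠ c • ((O (a i j')).act x - (O (b i j')).act y))
    (T : Finset L) {s : L} (hs : s ≠ 0) (hx : ∀ k, s * x k ∈ algCl ℝ (T : Set L))
    (hy : ∀ k, s * y k ∈ algCl ℝ (T : Set L)) : 2 * d ≤ T.card + I.card := by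
  have hscale : ∀ (u : Fin d → L) (i : Fin p), ∑ k, w i k * u k = 0 →
      ∑ k, s * u k * w i k = 0 := by
    intro u i h
    have := congrArg (s * ·) h
    simp only [Finset.mul_sum, mul_zero] at this
    rw [← this]
    exact Finset.sum_congr rfl fun j _ => by ring
  have h1 := sum_codim_le_card H.algebraicIndependent T
    (fun i => 1 + if (i : ℕ) < 2 * d - p ∧ i ∉ I then 1 else 0) ?_
  · rw [Finset.sum_add_distrib, Finset.sum_const, Finset.card_univ, Fintype.card_fin, smul_eq_mul,
      mul_one, Finset.sum_boole, Nat.cast_id] at h1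
    have h2 : 2 * d - p ≤ (Finset.univ.filter fun i : Fin p =>
        (i : ℕ) < 2 * d - p ∧ i ∉ I).card + I.card := by
      have h3 : (Finset.univ.filter fun i : Fin p => (i : ℕ) < 2 * d - p).card = 2 * d - p := by
        have := H.two_mul_le
        have := H.le_dim
        rw [Fin.card_filter_val_lt]
        omega
      refine h3.ge.trans (le_trans (Finset.card_le_card fun i hi => ?_) (Finset.card_union_le _ _))
      simp only [Finset.mem_filter, Finset.mem_univ, true_and, Finset.mem_union] at hi ⊢
      tauto
    omega
  · intro i
    by_cases hi : (i : ℕ) < 2 * d - p ∧ i ∉ I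
    · obtain ⟨j, j', hjj⟩ := hI i hi.1 hi.2
      have h2 := finrank_span_add_le (K := algCl ℝ (T : Set L)) (z := w i)
        (v := ![fun k => ⟨_, act_sub_act_mem_algCl (P := O (a i j)) (Q := O (b i j)) hx hy k⟩,
          fun k => ⟨_, act_sub_act_mem_algCl (P := O (a i j')) (Q := O (b i j')) hx hy k⟩]) ?_ ?_
      · simpa [hi] using h2
      · rw [LinearIndependent.pair_iff]
        intro α β hαβ
        have h3 : ∀ k, (α : L) * (s * ((O (a i j)).act x - (O (b i j)).act y) k) +
            (β : L) * (s * ((O (a i j')).act x - (O (b i j')).act y) k) = 0 := fun k => by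
          simpa using congrArg (algebraMap (algCl ℝ (T : Set L)) L) (congrFun hαβ k)
        have hα : α = 0 := by
          by_contra hα
          have hα' : (α : L) ≠ 0 := fun h => hα (Subtype.ext h)
          apply hjj (-((β : L) / α))
          funext k
          rw [Pi.smul_apply, smul_eq_mul]
          apply mul_left_cancel₀ (mul_ne_zero hα' hs)
          linear_combination h3 k + s * ((O (a i j')).act x - (O (b i j')).act y) k *
            mul_div_cancel₀ (β : L) hα'
        refine ⟨hα, ?_⟩
        by_contra hβ
        have hβ' : (β : L) ≠ 0 := fun h => hβ (Subtype.ext h)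
        apply H.ne_zero (a i j') (b i j')
        funext k
        simpa [hα, hβ', hs] using h3 k
      · intro l
        fin_cases l <;>
          simpa [Algebra.smul_def] using hscale _ i (H.sum_eq_zero i _)
    · have h2 := finrank_span_add_le (K := algCl ℝ (T : Set L)) (z := w i) (κ := Unit)
        (v := fun _ k => ⟨_, act_sub_act_mem_algCl (P := O (a i ⟨0, H.pos i⟩))
          (Q := O (b i ⟨0, H.pos i⟩)) hx hy k⟩) ?_ ?_
      · simpa only [if_neg hi, add_zero, Fintype.card_unit] using h2
      · rw [linearIndependent_unique_iff]
        intro h0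
        apply H.ne_zero (a i ⟨0, H.pos i⟩) (b i ⟨0, H.pos i⟩)
        funext k
        have := congrArg (algebraMap (algCl ℝ (T : Set L)) L) (congrFun h0 k)
        simpa [hs] using this
      · intro _
        simpa [Algebra.smul_def] using hscale _ i (H.sum_eq_zero i _)

theorem two_mul_add_one_le [DecidableEq L] (H : IsGenericCollision O r n γ a b x y w)
    {I : Finset (Fin p)}
    (hI : ∀ i : Fin p, (i : ℕ) < 2 * d - p → i ∉ I → ∃ j j', ∀ c : L,
      (O (a i j)).act x - (O (b i j)).act y ≠ c • ((O (a i j')).act x - (O (b i j')).act y))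
    (T : Finset L) {K : Type*} [Field K] [Algebra K L]
    (hK : ∀ c : K, algebraMap K L c ∈ algCl ℝ (T : Set L)) :
    2 * d + 1 ≤ T.card + Module.finrank K (Submodule.span K (Set.range (Sum.elim x y))) +
      I.card := by
  have hz : Sum.elim x y ≠ 0 := by
    intro h
    apply H.ne_zero 1 1
    have hx : x = 0 := funext fun k => congrFun h (Sum.inl k)
    have hy : y = 0 := funext fun k => congrFun h (Sum.inr k)
    rw [hx, hy, act_zero, sub_self]
  obtain ⟨T', -, hc, s, hs, hmem⟩ := exists_projective_generators hz T hK
  have h1 := H.two_mul_le_card_add_card hI T' hs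
    (fun k => hmem _ (Submodule.subset_span ⟨Sum.inl k, rfl⟩))
    (fun k => hmem _ (Submodule.subset_span ⟨Sum.inr k, rfl⟩))
  omega

theorem false_of_algebraMap_smul [DecidableEq L] (H : IsGenericCollision O r n γ a b x y w)
    {I : Finset (Fin p)}
    (hI : ∀ i : Fin p, (i : ℕ) < 2 * d - p → i ∉ I → ∃ j j', ∀ c : L,
      (O (a i j)).act x - (O (b i j)).act y ≠ c • ((O (a i j')).act x - (O (b i j')).act y))
    (hIγ : I.card ≤ γ) {i : Fin p} {j j' : Fin (m i)} (hr : γ ≤ r ((a i j')⁻¹ * a i j)) {c : ℝ}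
    (hc : (O (a i j)).act x - (O (b i j)).act y =
      algebraMap ℝ L c • ((O (a i j')).act x - (O (b i j')).act y)) : False := by
  have h1 : (O (a i j) - c • O (a i j')).act x = (O (b i j) - c • O (b i j')).act y := by
    rw [sub_act, sub_act, smul_act, smul_act]
    rw [algebraMap_smul, smul_sub] at hc
    linear_combination (exp := 1) hc
  have h2 := finrank_span_elim_add_rank_le h1
  have h3 : O (a i j) - c • O (a i j') = O (a i j') * (O ((a i j')⁻¹ * a i j) - c • 1) := by
    rw [mul_sub, ← map_mul, mul_inv_cancel_left, mul_smul_comm, mul_one]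
  rw [h3, rank_mul_eq_right_of_isUnit_det _ _ (H.isUnit_det _), Fintype.card_fin] at h2
  have h4 := H.le_rank ((a i j')⁻¹ * a i j) c
  have h5 := H.two_mul_add_one_le hI ∅ (K := ℝ) fun c => (algCl ℝ _).algebraMap_mem c
  rw [Finset.card_empty] at h5
  omega

end IsGenericCollision

end Collisions

section PlaneCollision

open Matrix

theorem det_sub_one_eq_zero {P : Matrix (Fin 2) (Fin 2) ℝ} (hP : P ∈ orthogonalGroup (Fin 2) ℝ)
    (h : P.det = -1) : (P - 1).det = 0 := by
  obtain ⟨a, b, hab, rfl⟩ := eq_reflection_of_det_eq_neg_one hP h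
  simp [det_fin_two, one_apply]
  linear_combination -hab

namespace IsGenericCollision

variable {p n γ : ℕ} {G L : Type*} [Group G] [Field L] [Algebra ℝ L]
  {O : G →* Matrix (Fin 2) (Fin 2) ℝ} {r : G → ℕ} {m : Fin p → ℕ}
  {a b : ∀ i, Fin (m i) → G} {x y : Fin 2 → L} {w : Fin p → Fin 2 → L}

theorem le_one_of_det_eq (H : IsGenericCollision O r n γ a b x y w) {g : G}
    (hg : (O g).det = -1) : r g ≤ 1 := by
  have h1 := H.le_rank g 1
  have h2 := exists_mulVec_eq_zero_iff.2 (det_sub_one_eq_zero (H.mem_orthogonalGroup g) hg)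
  rw [one_smul] at h1
  obtain ⟨v, hv, hv'⟩ := h2
  have h3 := (O g - 1).mulVecLin.finrank_range_add_finrank_ker
  have h4 : 0 < Module.finrank ℝ (O g - 1).mulVecLin.ker := by
    rw [Module.finrank_pos_iff_exists_ne_zero]
    exact ⟨⟨v, hv'⟩, fun h => hv (congrArg Subtype.val h)⟩
  rw [Module.finrank_fin_fun] at h3
  unfold rank at h1
  omega

variable [LinearOrder L] [IsStrictOrderedRing L]

theorem false_of_plane (H : IsGenericCollision O r n γ a b x y w) (hp : p = 2) (hγ : 2 ≤ γ)
    (hdeg : ∀ i j j', ∃ c : L, (O (a i j)).act x - (O (b i j)).act y =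
      c • ((O (a i j')).act x - (O (b i j')).act y))
    (s t : ∀ i, Fin (m i)) (hr : ∀ i, γ ≤ r ((a i (t i))⁻¹ * a i (s i))) (c : Fin p → L)
    (hc : ∀ i, Transcendental ℝ (c i))
    (hcu : ∀ i, (O (a i (s i))).act x - (O (b i (s i))).act y =
      c i • ((O (a i (t i))).act x - (O (b i (t i))).act y)) : False := by
  subst hp
  set h := a 0 (s 0)
  set k := b 0 (s 0)
  have hx : ∀ g, (O (g * h⁻¹)).act ((O h).act x) = (O g).act x := fun g => by
    rw [← act_mul, ← map_mul, inv_mul_cancel_right]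
  have hy : ∀ g, (O (g * k⁻¹)).act ((O k).act y) = (O g).act y := fun g => by
    rw [← act_mul, ← map_mul, inv_mul_cancel_right]
  set δ : G →* ℝ := detMonoidHom.comp O
  have hδ : ∀ g, δ g = 1 ∨ δ g = -1 := fun g => det_eq_one_or_neg_one (H.mem_orthogonalGroup g)
  have H' : IsGenericPencilFamily (fun i => O (a i (s i) * h⁻¹)) (fun i => O (b i (s i) * k⁻¹))
      (fun i => O (a i (t i) * h⁻¹)) (fun i => O (b i (t i) * k⁻¹)) ((O h).act x) ((O k).act y)
      c w :=
    { algebraicIndependent := H.algebraicIndependent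
      det_ne_zero := fun i => (H.isUnit_det _).ne_zero
      transcendental := hc
      ne_zero := fun i => by rw [hx, hy]; exact H.ne_zero _ _
      eq_smul := fun i => by rw [hx, hy, hx, hy]; exact hcu i
      sum_eq_zero := fun i => by rw [hx, hy]; exact H.sum_eq_zero i _ }
  have hE : δ (a 0 (t 0) * h⁻¹) = 1 := by
    refine (hδ (a 0 (t 0) * h⁻¹)).resolve_right fun h1 => ?_
    have h2 := hr 0
    have h3 : δ ((a 0 (t 0))⁻¹ * h) = -1 := by
      have h4 : δ (a 0 (t 0) * h⁻¹) * δ ((a 0 (t 0))⁻¹ * h) = 1 := by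
        calc δ (a 0 (t 0) * h⁻¹) * δ ((a 0 (t 0))⁻¹ * h)
            = (δ (a 0 (t 0)) * δ (a 0 (t 0))⁻¹) * (δ h⁻¹ * δ h) := by
              rw [map_mul, map_mul]
              ring
          _ = 1 := by
              rw [← map_mul, ← map_mul, mul_inv_cancel, inv_mul_cancel, map_one, one_mul]
      rw [h1] at h4
      linarith
    exact absurd (hγ.trans (h2.trans (H.le_one_of_det_eq h3))) (by norm_num)
  obtain ⟨i, ε, hε⟩ := H'.exists_det_eq (Fintype.card_fin 2) (i := 0) (by simp [h]) (by simp [k])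
    (H.mem_orthogonalGroup _) hE (H.mem_orthogonalGroup _)
  have hdet : ∀ j, δ (a i j * h⁻¹) = ε ∧ δ (b i j * k⁻¹) = -ε := by
    intro j
    obtain ⟨e, he⟩ := hdeg i j (s i)
    refine hε _ (H.mem_orthogonalGroup _) _ (H.mem_orthogonalGroup _) e ?_ ?_
    · rintro rfl
      apply H.ne_zero (a i j) (b i j)
      rw [he, zero_smul]
    · rw [hx, hy, hx, hy, he]
  have hconst : ∀ j, δ (a i j) = δ (a i (s i)) := by
    intro j
    have h1 := (hdet j).1.trans (hdet (s i)).1.symm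
    rw [map_mul, map_mul] at h1
    refine mul_right_cancel₀ (fun h0 => ?_) h1
    rcases hδ h⁻¹ with h2 | h2 <;> rw [h2] at h0 <;> norm_num at h0
  obtain ⟨g, hg⟩ : ∃ g, δ g = -1 := by
    obtain ⟨h1, h2⟩ := hdet (s i)
    rcases hδ (a i (s i) * h⁻¹) with h3 | h3
    · exact ⟨_, h2.trans (by linarith)⟩
    · exact ⟨_, h3⟩
  obtain ⟨g', hg'⟩ : ∃ g', ∀ j, δ (a i j * g') = -1 := by
    rcases hδ (a i (s i)) with h1 | h1
    · exact ⟨g, fun j => by rw [map_mul, hconst, h1, hg, one_mul]⟩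
    · exact ⟨1, fun j => by rw [mul_one, hconst, h1]⟩
  classical
  have h1 : (1 : G) ∉ Finset.univ.image fun j => a i j * g' := by
    intro h1
    obtain ⟨j, -, hj⟩ := Finset.mem_image.1 h1
    have h2 := hg' j
    rw [hj, map_one] at h2
    norm_num at h2
  have h2 : n ≤ (Finset.univ.image fun j => a i j * g').card + 1 := by
    rw [Finset.card_image_of_injective _ fun j j' h => H.injective i (mul_left_injective g' h),
      Finset.card_univ, Fintype.card_fin, H.eq_of_lt i (by omega)]
    omega
  obtain ⟨e, he, hre⟩ := H.exists_le _ h1 h2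
  obtain ⟨j, -, rfl⟩ := Finset.mem_image.1 he
  have := H.le_one_of_det_eq (hg' j)
  omega

end IsGenericCollision

end PlaneCollision

section NoCollision

open Matrix

namespace IsGenericCollision

variable {d p n γ : ℕ} {G L : Type*} [Group G] [Field L] [Algebra ℝ L]
  {O : G →* Matrix (Fin d) (Fin d) ℝ} {r : G → ℕ} {m : Fin p → ℕ} {a b : ∀ i, Fin (m i) → G}
  {x y : Fin d → L} {w : Fin p → Fin d → L}

theorem dim_le_card_of_transcendental [DecidableEq L] (H : IsGenericCollision O r n γ a b x y w)
    {I : Finset (Fin p)}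
    (hI : ∀ i : Fin p, (i : ℕ) < 2 * d - p → i ∉ I → ∃ j j', ∀ c : L,
      (O (a i j)).act x - (O (b i j)).act y ≠ c • ((O (a i j')).act x - (O (b i j')).act y))
    {i : Fin p} {j j' : Fin (m i)} {c : L} (hct : Transcendental ℝ c)
    (hc : (O (a i j)).act x - (O (b i j)).act y =
      c • ((O (a i j')).act x - (O (b i j')).act y)) : d ≤ I.card := by
  have hcT : c ∈ algCl ℝ (({c} : Finset L) : Set L) := subset_algCl _ (by simp)
  have hct' : Transcendental ℝ (⟨c, hcT⟩ : algCl ℝ (({c} : Finset L) : Set L)) := by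
    rwa [← transcendental_algebraMap_iff (R := ℝ) (S := algCl ℝ (({c} : Finset L) : Set L)) (A := L)
      (FaithfulSMul.algebraMap_injective _ _)]
  obtain ⟨M, hM, -⟩ := exists_pencil_parametrization (H.isUnit_det (a i j)).ne_zero hct' hc
  have h1 := H.two_mul_add_one_le hI {c} (K := algCl ℝ (({c} : Finset L) : Set L)) fun e => e.2
  have h2 : (1 : Matrix (Fin d) (Fin d) (algCl ℝ (({c} : Finset L) : Set L))).act x = M.act y := by
    rw [one_act, hM]
  have h3 := finrank_span_elim_add_rank_le h2
  rw [rank_one, Fintype.card_fin] at h3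
  rw [Finset.card_singleton] at h1
  omega

theorem exists_pair (H : IsGenericCollision O r n γ a b x y w) {i : Fin p}
    (hi : (i : ℕ) < 2 * d - p) : ∃ s t : Fin (m i), γ ≤ r ((a i t)⁻¹ * a i s) := by
  classical
  have h1 : (1 : G) ∉ (Finset.univ.erase (⟨0, H.pos i⟩ : Fin (m i))).image
      fun j => (a i ⟨0, H.pos i⟩)⁻¹ * a i j := by
    intro h
    obtain ⟨j, hj, h⟩ := Finset.mem_image.1 h
    exact Finset.ne_of_mem_erase hj (H.injective i (inv_mul_eq_one.1 h).symm)
  have h2 : n ≤ ((Finset.univ.erase (⟨0, H.pos i⟩ : Fin (m i))).image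
      fun j => (a i ⟨0, H.pos i⟩)⁻¹ * a i j).card + 1 := by
    rw [Finset.card_image_of_injective _ fun j j' h => H.injective i (mul_right_injective _ h),
      Finset.card_erase_of_mem (Finset.mem_univ _), Finset.card_univ, Fintype.card_fin,
      H.eq_of_lt i hi]
    omega
  obtain ⟨g, hg, hr⟩ := H.exists_le _ h1 h2
  obtain ⟨j, -, rfl⟩ := Finset.mem_image.1 hg
  exact ⟨j, _, hr⟩

theorem false_of_isAlgebraic_imp [LinearOrder L] [IsStrictOrderedRing L]
    (H : IsGenericCollision O r n γ a b x y w) (hd : 2 ≤ d)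
    (hL : ∀ c : L, IsAlgebraic ℝ c → c ∈ Set.range (algebraMap ℝ L)) : False := by
  classical
  let I : Finset (Fin p) := Finset.univ.filter fun i => (i : ℕ) < 2 * d - p ∧
    ∀ j j', ∃ c : L, (O (a i j)).act x - (O (b i j)).act y =
      c • ((O (a i j')).act x - (O (b i j')).act y)
  have hI : ∀ i : Fin p, (i : ℕ) < 2 * d - p → i ∉ I → ∃ j j', ∀ c : L,
      (O (a i j)).act x - (O (b i j)).act y ≠
        c • ((O (a i j')).act x - (O (b i j')).act y) := by
    intro i hi hiI
    by_contra! h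
    exact hiI (Finset.mem_filter.2 ⟨Finset.mem_univ _, hi, h⟩)
  have hlt : ∀ i ∈ I, (i : ℕ) < 2 * d - p := fun i hi => (Finset.mem_filter.1 hi).2.1
  have hdeg : ∀ i ∈ I, ∀ j j', ∃ c : L, (O (a i j)).act x - (O (b i j)).act y =
      c • ((O (a i j')).act x - (O (b i j')).act y) := fun i hi => (Finset.mem_filter.1 hi).2.2
  have hcard : I.card ≤ 2 * d - p := by
    refine (Finset.card_le_card fun i hi => Finset.mem_filter.2
      ⟨Finset.mem_univ i, hlt i hi⟩).trans ?_
    rw [Fin.card_filter_val_lt]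
    exact min_le_right _ _
  have hdims := And.intro H.two_mul_le H.le_dim
  have hγ : I.card ≤ γ := by omega
  have hne : ∀ i, Nonempty (Fin (m i)) := fun i => ⟨⟨0, H.pos i⟩⟩
  choose! s t hst using fun i (hi : i ∈ I) => H.exists_pair (hlt i hi)
  choose! c hc using fun i (hi : i ∈ I) => hdeg i hi (s i) (t i)
  have htr : ∀ i ∈ I, Transcendental ℝ (c i) := by
    intro i hi h
    obtain ⟨e, he⟩ := hL _ h
    exact H.false_of_algebraMap_smul hI hγ (hst i hi) (by rw [he]; exact hc i hi)
  obtain ⟨i, hi⟩ : I.Nonempty := by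
    rw [Finset.nonempty_iff_ne_empty]
    intro h0
    have h1 := H.two_mul_add_one_le hI ∅ (K := ℝ) fun c => (algCl ℝ _).algebraMap_mem c
    have h2 := finrank_range_le_card (R := ℝ) (Sum.elim x y)
    rw [Set.finrank, Fintype.card_sum, Fintype.card_fin] at h2
    rw [h0, Finset.card_empty, Finset.card_empty] at h1
    omega
  have hdI := H.dim_le_card_of_transcendental hI (htr i hi) (hc i hi)
  have hpd : p = d := by omega
  have hall : ∀ i, i ∈ I := by
    rw [← Finset.eq_univ_iff_forall, ← Finset.card_eq_iff_eq_univ, Fintype.card_fin]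
    omega
  have hfam : IsGenericPencilFamily (fun i => O (a i (s i))) (fun i => O (b i (s i)))
      (fun i => O (a i (t i))) (fun i => O (b i (t i))) x y c w :=
    { algebraicIndependent := H.algebraicIndependent
      det_ne_zero := fun i => (H.isUnit_det _).ne_zero
      transcendental := fun i => htr i (hall i)
      ne_zero := fun i => H.ne_zero _ _
      eq_smul := fun i => hc i (hall i)
      sum_eq_zero := fun i => H.sum_eq_zero i _ }
  have h2 := hfam.card_le_two (by simpa using hpd)
  rw [Fintype.card_fin] at h2
  obtain rfl : d = 2 := by omega
  exact H.false_of_plane hpd (by omega) (fun i => hdeg i (hall i)) s t (fun i => hst i (hall i)) c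
    (fun i => htr i (hall i)) fun i => hc i (hall i)

end IsGenericCollision

end NoCollision

section PolynomialZeroSet

theorem volume_setOf_eval_eq_zero {n : ℕ} {P : MvPolynomial (Fin n) ℝ} (hP : P ≠ 0) :
    volume {v : Fin n → ℝ | MvPolynomial.eval v P = 0} = 0 := by
  induction n with
  | zero =>
    obtain ⟨c, rfl⟩ := MvPolynomial.C_surjective (Fin 0) P
    have hc : c ≠ 0 := by
      rintro rfl
      simp at hP
    simp [hc]
  | succ n ih =>
    have hQ : MvPolynomial.finSuccEquiv ℝ n P ≠ 0 := by simpa using hP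
    have hmeas : MeasurableSet {v : Fin (n + 1) → ℝ | MvPolynomial.eval v P = 0} :=
      (isClosed_singleton.preimage (MvPolynomial.continuous_eval P)).measurableSet
    have he := volume_preserving_piFinSuccAbove (fun _ : Fin (n + 1) => ℝ) 0
    rw [← he.symm.measure_preimage hmeas.nullMeasurableSet, Measure.volume_eq_prod]
    have hmeas' := measurable_swap (he.symm.measurable hmeas)
    have hlead := ih (Polynomial.leadingCoeff_ne_zero.2 hQ)
    rw [← Measure.prod_swap, Measure.map_apply measurable_swap (he.symm.measurable hmeas),
      Measure.measure_prod_null hmeas']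
    filter_upwards [compl_mem_ae_iff.2 hlead] with s hs
    have hne : Polynomial.map (MvPolynomial.eval s) (MvPolynomial.finSuccEquiv ℝ n P) ≠ 0 := by
      intro h
      have h' := congrArg (Polynomial.coeff · (MvPolynomial.finSuccEquiv ℝ n P).natDegree) h
      simp only [Polynomial.coeff_map, Polynomial.coeff_natDegree, Polynomial.coeff_zero] at h'
      exact hs h'
    refine measure_mono_null (fun t ht => ?_)
      ((Polynomial.finite_setOfPred_isRoot hne).measure_zero _)
    have ht' : MvPolynomial.eval (Fin.cons t s : Fin (n + 1) → ℝ) P = 0 := by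
      rw [← Fin.insertNth_zero']
      exact ht
    rwa [MvPolynomial.eval_eq_eval_mv_eval'] at ht'

theorem measure_setOf_eval_eq_zero {E ι : Type*} [Fintype ι] [NormedAddCommGroup E]
    [NormedSpace ℝ E] [MeasurableSpace E] [BorelSpace E] (μ : Measure E)
    [μ.IsAddHaarMeasure] (e : E ≃L[ℝ] (ι → ℝ)) {P : MvPolynomial ι ℝ} (hP : P ≠ 0) :
    μ {v | MvPolynomial.eval (e v) P = 0} = 0 := by
  let σ := Fintype.equivFin ι
  let e' : E ≃L[ℝ] (Fin (Fintype.card ι) → ℝ) :=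
    e.trans (ContinuousLinearEquiv.piCongrLeft ℝ (fun _ => ℝ) σ)
  have hQ : MvPolynomial.rename σ P ≠ 0 := by
    rwa [Ne, map_eq_zero_iff _ (MvPolynomial.rename_injective _ σ.injective)]
  have h := volume_setOf_eval_eq_zero hQ
  have : FiniteDimensional ℝ E := e.symm.toLinearEquiv.finiteDimensional
  have hac : μ ≪ volume.map e'.symm := Measure.absolutelyContinuous_isAddHaarMeasure _ _
  refine hac ?_
  have hcl : IsClosed {v | MvPolynomial.eval (e v) P = 0} :=
    isClosed_singleton.preimage ((MvPolynomial.continuous_eval P).comp e.continuous)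
  rw [Measure.map_apply e'.symm.continuous.measurable hcl.measurableSet]
  convert h using 2
  ext v
  have hv : e (e'.symm v) = v ∘ σ := by
    funext k
    simp [e', ContinuousLinearEquiv.piCongrLeft, Equiv.piCongrLeft, Equiv.piCongrLeft']
    rfl
  simp [MvPolynomial.eval_rename, hv]

theorem measure_eq_zero_and_isNowhereDense_of_eval_eq_zero {E ι : Type*} [Fintype ι]
    [NormedAddCommGroup E] [NormedSpace ℝ E] [MeasurableSpace E] [BorelSpace E] (μ : Measure E)
    [μ.IsAddHaarMeasure] (e : E ≃L[ℝ] (ι → ℝ)) {P : MvPolynomial ι ℝ} (hP : P ≠ 0) {F : Set E}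
    (hF : ∀ v ∈ F, MvPolynomial.eval (e v) P = 0) : μ F = 0 ∧ IsNowhereDense F := by
  have h := measure_setOf_eval_eq_zero μ e hP
  have hcl : IsClosed {v | MvPolynomial.eval (e v) P = 0} :=
    isClosed_singleton.preimage ((MvPolynomial.continuous_eval P).comp e.continuous)
  exact ⟨measure_mono_null hF h, (IsNowhereDense.of_isClosed_null hcl h).mono hF⟩

end PolynomialZeroSet

theorem mem_range_algebraMap_of_isAlgebraic {L : Type*} [Field L] [LinearOrder L]
    [IsStrictOrderedRing L] [Algebra ℝ L] {c : L} (hc : IsAlgebraic ℝ c) :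
    c ∈ Set.range (algebraMap ℝ L) := by
  have h_int : IsIntegral ℝ c := hc.isIntegral
  have := IntermediateField.isAlgebraic_adjoin_simple h_int
  rcases Real.nonempty_algEquiv_or (IntermediateField.adjoin ℝ {c}) with ⟨⟨e⟩⟩ | ⟨⟨e⟩⟩
  · refine ⟨e ⟨c, IntermediateField.mem_adjoin_simple_self ℝ c⟩, ?_⟩
    rw [IsScalarTower.algebraMap_apply ℝ (IntermediateField.adjoin ℝ {c}) L, ← e.symm.commutes]
    simp
  · exfalso
    have h1 : (e.symm Complex.I) ^ 2 = -1 := by rw [← map_pow, Complex.I_sq, map_neg, map_one]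
    have h2 := congrArg (algebraMap _ L) h1
    rw [map_pow, map_neg, map_one] at h2
    nlinarith [sq_nonneg (algebraMap (IntermediateField.adjoin ℝ {c}) L (e.symm Complex.I))]

theorem exists_orderedField_of_ultrafilter {α : Type} (𝒰 : Ultrafilter α) :
    ∃ (L : Type) (_ : Field L) (_ : LinearOrder L) (_ : IsStrictOrderedRing L) (_ : Algebra ℝ L)
      (φ : (α → ℝ) →ₐ[ℝ] L), ∀ f, φ f = 0 ↔ ∀ᶠ w in (𝒰 : Filter α), f w = 0 := by
  let c : ℝ →+* (𝒰 : Filter α).Germ ℝ :=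
    (Filter.Germ.coeRingHom (𝒰 : Filter α)).comp (Pi.constRingHom α ℝ)
  refine ⟨(𝒰 : Filter α).Germ ℝ, inferInstance, inferInstance, inferInstance, c.toAlgebra, ?_⟩
  let := c.toAlgebra
  refine ⟨{ Filter.Germ.coeRingHom (𝒰 : Filter α) with commutes' := fun r => rfl }, fun f => ?_⟩
  exact Filter.Germ.coe_eq


section OrthogonalRepresentation

variable {d : ℕ} {G : Type} [Group G]
  (U : G →* (EuclideanSpace ℝ (Fin d) ≃ₗᵢ[ℝ] EuclideanSpace ℝ (Fin d)))

/-- The matrices of an orthogonal representation in the standard basis. -/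
noncomputable def repMatrix : G →* Matrix (Fin d) (Fin d) ℝ where
  toFun g := LinearMap.toMatrix (EuclideanSpace.basisFun (Fin d) ℝ).toBasis
    (EuclideanSpace.basisFun (Fin d) ℝ).toBasis ((U g).toLinearEquiv :
      EuclideanSpace ℝ (Fin d) →ₗ[ℝ] EuclideanSpace ℝ (Fin d))
  map_one' := by
    rw [map_one]
    exact LinearMap.toMatrix_id _
  map_mul' g h := by
    rw [map_mul, ← LinearMap.toMatrix_comp]
    rfl

theorem repMatrix_mem_orthogonalGroup (g : G) :
    repMatrix U g ∈ Matrix.orthogonalGroup (Fin d) ℝ :=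
  LinearIsometryEquiv.toMatrix_mem_unitaryGroup (U g) (EuclideanSpace.basisFun (Fin d) ℝ)
    (EuclideanSpace.basisFun (Fin d) ℝ)

theorem apply_eq_sum_repMatrix (g : G) (x : EuclideanSpace ℝ (Fin d)) (k : Fin d) :
    (U g) x k = ∑ l, repMatrix U g k l * x l := by
  have h := congrFun (LinearMap.toMatrix_mulVec_repr
    (EuclideanSpace.basisFun (Fin d) ℝ).toBasis (EuclideanSpace.basisFun (Fin d) ℝ).toBasis
    ((U g).toLinearEquiv : EuclideanSpace ℝ (Fin d) →ₗ[ℝ] EuclideanSpace ℝ (Fin d)) x) k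
  simpa [Matrix.mulVec, dotProduct, repMatrix] using h.symm

variable [Fintype G]

theorem rankMin_le_rank (g : G) (c : ℝ) : rankMin U g ≤ (repMatrix U g - c • 1).rank := by
  refine Nat.sInf_le ⟨c, ?_⟩
  have h : Matrix.toLin (EuclideanSpace.basisFun (Fin d) ℝ).toBasis
      (EuclideanSpace.basisFun (Fin d) ℝ).toBasis (repMatrix U g) =
      ((U g).toLinearEquiv : EuclideanSpace ℝ (Fin d) →ₗ[ℝ] EuclideanSpace ℝ (Fin d)) := by
    simp [repMatrix]
  rw [Matrix.rank_eq_finrank_range_toLin _ (EuclideanSpace.basisFun (Fin d) ℝ).toBasis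
    (EuclideanSpace.basisFun (Fin d) ℝ).toBasis, map_sub, map_smul, Matrix.toLin_one, h]

theorem rankMin_le_dim (g : G) : rankMin U g ≤ d := by
  simpa using (rankMin_le_rank U g 0).trans (Matrix.rank_le_card_height _)

variable [DecidableEq G]

theorem length_gammaSorted : (gammaSorted U).length = Fintype.card G - 1 := by
  simp [gammaSorted, Finset.filter_ne']

theorem gammaSorted_getD_le_dim (k : ℕ) : (gammaSorted U).getD k 0 ≤ d := by
  rw [List.getD_eq_getElem?_getD]
  rcases h : (gammaSorted U)[k]? with _ | t
  · simp
  · have ht := List.mem_of_getElem? h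
    simp only [gammaSorted, Multiset.mem_sort, Multiset.mem_map] at ht
    obtain ⟨g, -, rfl⟩ := ht
    exact rankMin_le_dim U g

theorem exists_mem_gammaSorted_le {n : ℕ} (hn2 : 2 ≤ n) (hnN : n ≤ Fintype.card G - 1)
    {S : Finset G} (h1 : 1 ∉ S) (hS : n ≤ S.card + 1) :
    ∃ g ∈ S, (gammaSorted U).getD (n - 2) 0 ≤ rankMin U g := by
  by_contra! hlt
  set l := gammaSorted U with hl
  set γ := l.getD (n - 2) 0 with hγ
  have hlen : l.length = Fintype.card G - 1 := length_gammaSorted U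
  have hsort : l.Pairwise (· ≤ ·) := Multiset.pairwise_sort _ _
  have hcount : S.card ≤ l.countP (· < γ) := by
    have hle : S.val.map (rankMin U) ≤ (l : Multiset ℕ) := by
      rw [hl, gammaSorted, Multiset.sort_eq]
      refine Multiset.map_le_map (Finset.val_le_iff.2 fun g hg => ?_)
      simp only [Finset.mem_filter, Finset.mem_univ, true_and]
      rintro rfl
      exact h1 hg
    have h2 := Multiset.countP_le_of_le (· < γ) hle
    rw [Multiset.coe_countP] at h2
    refine le_trans (le_of_eq ?_) h2
    rw [Multiset.countP_eq_card.2]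
    · simp
    · intro t ht
      obtain ⟨g, hg, rfl⟩ := Multiset.mem_map.1 ht
      exact hlt g hg
  have hdrop : (l.drop (n - 2)).countP (· < γ) = 0 := by
    rw [List.countP_eq_zero]
    intro t ht
    have hpos : n - 2 < l.length := by omega
    rw [List.drop_eq_getElem_cons hpos] at ht
    have hγ' : γ = l[n - 2] := List.getD_eq_getElem _ _ hpos
    have hs' := (hsort.drop : (l.drop (n - 2)).Pairwise (· ≤ ·))
    rw [List.drop_eq_getElem_cons hpos, List.pairwise_cons] at hs'
    rcases List.mem_cons.1 ht with rfl | ht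
    · simp [hγ']
    · simpa [hγ'] using hs'.1 t ht
  rw [← List.take_append_drop (n - 2) l, List.countP_append, hdrop] at hcount
  have := hcount.trans
    (Nat.add_le_add_right (List.countP_le_length.trans (List.length_take_le _ _)) 0)
  omega

end OrthogonalRepresentation

section Specialization

theorem exists_ultrafilter_eval_ne_zero {α σ : Type} (v : α → σ → ℝ)
    (h : ∀ P : MvPolynomial σ ℝ, P ≠ 0 → ∃ w, MvPolynomial.eval (v w) P ≠ 0) :
    ∃ 𝒰 : Ultrafilter α, ∀ P : MvPolynomial σ ℝ, P ≠ 0 →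
      ∀ᶠ w in (𝒰 : Filter α), MvPolynomial.eval (v w) P ≠ 0 := by
  let f : {P : MvPolynomial σ ℝ // P ≠ 0} → Filter α := fun P =>
    Filter.principal {w | MvPolynomial.eval (v w) P.1 ≠ 0}
  have : Nonempty {P : MvPolynomial σ ℝ // P ≠ 0} := ⟨1, one_ne_zero⟩
  have hdir : Directed (· ≥ ·) f := by
    rintro ⟨P, hP⟩ ⟨Q, hQ⟩
    refine ⟨⟨P * Q, mul_ne_zero hP hQ⟩, ?_, ?_⟩ <;>
    · refine Filter.principal_mono.2 fun w hw => ?_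
      simp only [Set.mem_ofPred_eq, map_mul, mul_ne_zero_iff] at hw ⊢
      tauto
  have hne : (⨅ P, f P).NeBot := Filter.iInf_neBot_of_directed' hdir fun P =>
    Filter.principal_neBot_iff.2 (h P.1 P.2)
  refine ⟨Ultrafilter.of (⨅ P, f P), fun P hP => ?_⟩
  exact ((Ultrafilter.of_le _).trans (iInf_le f ⟨P, hP⟩)) (Filter.mem_principal_self _)

theorem map_act {α L : Type*} [Field L] [Algebra ℝ L] {ι κ : Type*} [Fintype ι]
    (φ : (α → ℝ) →ₐ[ℝ] L) (N : Matrix κ ι ℝ) (X : α → ι → ℝ) (k : κ) :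
    N.act (fun l => φ fun w => X w l) k = φ fun w => ∑ l, N k l * X w l := by
  have h : (fun w => ∑ l, N k l * X w l) = ∑ l, N k l • fun w => X w l := by
    ext w
    simp
  rw [h, map_sum]
  simp [Matrix.act]

theorem algebraicIndependent_of_eventually_eval_ne_zero {α σ : Type} {L : Type*} [Field L]
    [Algebra ℝ L] {𝒰 : Filter α} {φ : (α → ℝ) →ₐ[ℝ] L} {v : α → σ → ℝ} [𝒰.NeBot]
    (hφ : ∀ f, φ f = 0 ↔ ∀ᶠ w in 𝒰, f w = 0)
    (h : ∀ P : MvPolynomial σ ℝ, P ≠ 0 → ∀ᶠ w in 𝒰, MvPolynomial.eval (v w) P ≠ 0) :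
    AlgebraicIndependent ℝ fun s => φ fun w => v w s := by
  rw [algebraicIndependent_iff]
  intro P hP
  by_contra hne
  have h1 : MvPolynomial.aeval (fun s => φ fun w => v w s) P =
      φ (MvPolynomial.aeval (fun s w => v w s) P) :=
    (MvPolynomial.comp_aeval_apply _ φ P).symm
  rw [h1, hφ] at hP
  obtain ⟨w, hw, hw'⟩ := (hP.and (h P hne)).exists
  apply hw'
  rw [← hw, ← MvPolynomial.aeval_eq_eval]
  have h2 := MvPolynomial.comp_aeval_apply (fun s w => v w s)
    (Pi.evalAlgHom ℝ (fun _ : α => ℝ) w) P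
  exact h2.symm

end Specialization

theorem inner_eq_sum_mul {d : ℕ} (u v : EuclideanSpace ℝ (Fin d)) :
    ⟪u, v⟫ = ∑ k, u k * v k := by
  simp [PiLp.inner_apply, mul_comm]

theorem exists_ne_zero_eval_eq_zero_of_collision {d : ℕ} (hd : 2 ≤ d) {G : Type} [Group G]
    [Fintype G] [DecidableEq G]
    (U : G →* (EuclideanSpace ℝ (Fin d) ≃ₗᵢ[ℝ] EuclideanSpace ℝ (Fin d)))
    (n p : ℕ) (hn2 : 2 ≤ n) (hnN : n ≤ Fintype.card G - 1)
    (hpn : 2 * d - (gammaSorted U).getD (n - 2) 0 ≤ p) (hp2d : p ≤ 2 * d)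
    (m : Fin p → ℕ)
    (hm1 : ∀ i : Fin p, (i : ℕ) < 2 * d - p → m i = n)
    (hm2 : ∀ i : Fin p, 2 * d - p ≤ (i : ℕ) → m i = 1)
    (a b : (i : Fin p) → Fin (m i) → G) (ha : ∀ i, Function.Injective (a i)) :
    ∃ P : MvPolynomial (Fin p × Fin d) ℝ, P ≠ 0 ∧
      ∀ (w : Fin p → EuclideanSpace ℝ (Fin d)) (x y : EuclideanSpace ℝ (Fin d)),
        (¬∃ g : G, (U g) x = y) →
        (∀ (i : Fin p) (j : Fin (m i)), ⟪w i, (U (a i j)) x - (U (b i j)) y⟫ = 0) →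
        MvPolynomial.eval (fun ij => w ij.1 ij.2) P = 0 := by
  by_contra! hcon
  let α : Type := {t : (Fin p → EuclideanSpace ℝ (Fin d)) × EuclideanSpace ℝ (Fin d) ×
    EuclideanSpace ℝ (Fin d) // (¬∃ g : G, (U g) t.2.1 = t.2.2) ∧
      ∀ (i : Fin p) (j : Fin (m i)), ⟪t.1 i, (U (a i j)) t.2.1 - (U (b i j)) t.2.2⟫ = 0}
  obtain ⟨𝒰, h𝒰⟩ := exists_ultrafilter_eval_ne_zero
    (fun (t : α) (ij : Fin p × Fin d) => t.1.1 ij.1 ij.2) fun P hP => by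
      obtain ⟨w, x, y, h1, h2, h3⟩ := hcon P hP
      exact ⟨⟨(w, x, y), not_exists.2 h1, h2⟩, h3⟩
  obtain ⟨L, _, _, _, _, φ, hφ⟩ := exists_orderedField_of_ultrafilter 𝒰
  have hx : ∀ g k, (repMatrix U g).act (fun l => φ fun t : α => t.1.2.1 l) k =
      φ fun t => (U g) t.1.2.1 k := fun g k => by
    simp only [apply_eq_sum_repMatrix]
    exact map_act φ _ (fun (t : α) l => t.1.2.1 l) k
  have hy : ∀ g k, (repMatrix U g).act (fun l => φ fun t : α => t.1.2.2 l) k =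
      φ fun t => (U g) t.1.2.2 k := fun g k => by
    simp only [apply_eq_sum_repMatrix]
    exact map_act φ _ (fun (t : α) l => t.1.2.2 l) k
  have H : IsGenericCollision (repMatrix U) (rankMin U) n ((gammaSorted U).getD (n - 2) 0) a b
      (fun l => φ fun t : α => t.1.2.1 l) (fun l => φ fun t : α => t.1.2.2 l)
      (fun i k => φ fun t : α => t.1.1 i k) :=
    { mem_orthogonalGroup := repMatrix_mem_orthogonalGroup U
      le_rank := rankMin_le_rank U
      exists_le := fun S h1 hS => exists_mem_gammaSorted_le U hn2 hnN h1 hS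
      le_dim := gammaSorted_getD_le_dim U _
      two_mul_le := by omega
      le_two_mul := hp2d
      eq_of_lt := hm1
      pos := fun i => by
        rcases lt_or_ge (i : ℕ) (2 * d - p) with h | h
        · have := hm1 i h
          omega
        · have := hm2 i h
          omega
      injective := ha
      ne_zero := fun g h h0 => by
        have h1 : ∀ k, ∀ᶠ t : α in 𝒰, (U g) t.1.2.1 k - (U h) t.1.2.2 k = 0 := fun k => by
          rw [← hφ fun t : α => (U g) t.1.2.1 k - (U h) t.1.2.2 k]
          have h2 := congrFun h0 k
          rw [Pi.sub_apply, hx, hy, ← map_sub] at h2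
          exact h2
        obtain ⟨t, ht⟩ := (Filter.eventually_all.2 h1).exists
        have h3 : (U g) t.1.2.1 = (U h) t.1.2.2 := by
          ext k
          exact sub_eq_zero.1 (ht k)
        refine t.2.1 ⟨h⁻¹ * g, ?_⟩
        have h4 : (U (h⁻¹ * h)) t.1.2.2 = t.1.2.2 := by
          rw [inv_mul_cancel, map_one]
          rfl
        rw [map_mul] at h4 ⊢
        exact (congrArg (U h⁻¹) h3).trans h4
      algebraicIndependent := algebraicIndependent_of_eventually_eval_ne_zero hφ h𝒰
      sum_eq_zero := fun i j => by
        simp only [Pi.sub_apply, hx, hy, ← map_sub, ← map_mul, ← map_sum]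
        rw [hφ]
        refine Filter.Eventually.of_forall fun t => ?_
        have h := t.2.2 i j
        rw [inner_eq_sum_mul] at h
        rw [Finset.sum_apply]
        exact h }
  exact H.false_of_isAlgebraic_imp hd fun c hc => mem_range_algebraMap_of_isAlgebraic hc


/-- with `p_n = 2d − γ_{N−n+1}` and `p_n ≤ p ≤ 2d`, set `m_i = n` for the
first `2d − p` indices and `m_i = 1` for the rest.  For every choice of tuples
`a_i, b_i ∈ G^{m_i}` with pairwise distinct entries, the set
`F = {w ∈ V^p : ∃ x ≁ y, ⟨w_i, U_{a_i(j)}x − U_{b_i(j)}y⟩ = 0 ∀ i, j}` has Lebesgue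
measure zero and is nowhere dense in `V^p`. -/
theorem stmt19 {d : ℕ} (hd : 2 ≤ d) {G : Type} [Group G] [Fintype G] [DecidableEq G]
    (U : G →* (EuclideanSpace ℝ (Fin d) ≃ₗᵢ[ℝ] EuclideanSpace ℝ (Fin d)))
    (n p : ℕ) (hn2 : 2 ≤ n) (hnN : n ≤ Fintype.card G - 1)
    (hpn : 2 * d - (gammaSorted U).getD (n - 2) 0 ≤ p) (hp2d : p ≤ 2 * d)
    (m : Fin p → ℕ)
    (hm1 : ∀ i : Fin p, (i : ℕ) < 2 * d - p → m i = n)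
    (hm2 : ∀ i : Fin p, 2 * d - p ≤ (i : ℕ) → m i = 1)
    (a b : (i : Fin p) → Fin (m i) → G)
    (ha : ∀ i, Function.Injective (a i)) (hb : ∀ i, Function.Injective (b i))
    (F : Set (Fin p → EuclideanSpace ℝ (Fin d)))
    (hF : F = {w : Fin p → EuclideanSpace ℝ (Fin d) | ∃ x y : EuclideanSpace ℝ (Fin d),
      (¬∃ g : G, (U g) x = y) ∧
      ∀ (i : Fin p) (j : Fin (m i)), ⟪w i, (U (a i j)) x - (U (b i j)) y⟫ = 0}) :
    volume F = 0 ∧ IsNowhereDense F := by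
  obtain ⟨P, hP, h⟩ := exists_ne_zero_eval_eq_zero_of_collision hd U n p hn2 hnN hpn hp2d m hm1 hm2
    a b ha
  let e : (Fin p → EuclideanSpace ℝ (Fin d)) ≃L[ℝ] (Fin p × Fin d → ℝ) :=
    (ContinuousLinearEquiv.piCongrRight fun _ => EuclideanSpace.equiv (Fin d) ℝ).trans
      (LinearEquiv.curry ℝ ℝ (Fin p) (Fin d)).symm.toContinuousLinearEquiv
  refine measure_eq_zero_and_isNowhereDense_of_eval_eq_zero volume e hP fun w hw => ?_
  rw [hF] at hw
  obtain ⟨x, y, h1, h2⟩ := hw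
  exact h w x y h1 h2
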